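/- Fix an integer k ≥ 1, let q^k(n) denote the k-fold iterate of the n-th prime function applied to n, and define g(x) = x·(log x + log log x − 1) for real x > 1 with g^{(k)} its k-fold iterate. Then for all sufficiently large n, q^k(n) > g^{(k)}(n). -/

import Mathlib

open Filter Real

/-- `nthPrime n` is the `n`-th prime with 1-based indexing: `nthPrime 1 = 2`. -/
noncomputable def nthPrime (n : ℕ) : ℕ := Nat.nth Nat.Prime (n - 1)

/-- `q k n` is the prime-indexed prime of prime-index order `k`:
`q 0 n = n` and `q (k+1) n = p_{q k n}`. -/
noncomputable def q (k n : ℕ) : ℕ := nthPrime^[k] n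

/-- The lower-bound function in Dusart's bound: `g x = x·(log x + log log x − 1)`. -/
noncomputable def g (x : ℝ) : ℝ := x * (Real.log x + Real.log (Real.log x) - 1)

/-- The entire function `(s - 1) ζ(s)`. -/
noncomputable def zetaRegular : ℂ → ℂ :=
  Function.update (fun s ↦ (s - 1) * riemannZeta s) 1 1

lemma zetaRegular_of_ne {s : ℂ} (hs : s ≠ 1) : zetaRegular s = (s - 1) * riemannZeta s := by
  simp [zetaRegular, hs]

lemma differentiable_zetaRegular : Differentiable ℂ zetaRegular := by
  have hne {s : ℂ} (hs : s ≠ 1) : DifferentiableAt ℂ zetaRegular s := by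
    have h : DifferentiableAt ℂ (fun s ↦ (s - 1) * riemannZeta s) s :=
      (by fun_prop : DifferentiableAt ℂ (fun s : ℂ ↦ s - 1) s).mul (differentiableAt_riemannZeta hs)
    refine h.congr_of_eventuallyEq ?_
    filter_upwards [isOpen_ne.mem_nhds hs] with z hz using zetaRegular_of_ne hz
  intro s
  by_cases hs : s = 1
  · subst hs
    refine (Complex.analyticAt_of_differentiable_on_punctured_nhds_of_continuousAt ?_ ?_).differentiableAt
    · filter_upwards [self_mem_nhdsWithin] with z hz using hne hz
    · rw [zetaRegular, continuousAt_update_same]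
      exact riemannZeta_residue_one
  · exact hne hs

lemma zetaRegular_ne_zero {s : ℂ} (hs : 1 ≤ s.re) : zetaRegular s ≠ 0 := by
  by_cases h : s = 1
  · simp [h, zetaRegular]
  · rw [zetaRegular_of_ne h]
    exact mul_ne_zero (sub_ne_zero.2 h) (riemannZeta_ne_zero_of_one_le_re hs)

/-- `(s - 1)` times the difference between `(n + 1) ^ (-s)` and the integral of `x ^ (-s)` over
`[n, n + 1]`. -/
noncomputable def zetaTerm (n : ℕ) (s : ℂ) : ℂ :=
  (s - 1) * ((n : ℂ) + 1) ^ (-s) + (((n : ℂ) + 1) ^ (1 - s) - (n : ℂ) ^ (1 - s))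

lemma norm_cpow_neg_sub_le {a : ℝ} (ha : 0 < a) {s : ℂ} (hs : 0 < s.re) {x y : ℝ}
    (hx : x ∈ Set.Icc a (a + 1)) (hy : y ∈ Set.Icc a (a + 1)) :
    ‖(y : ℂ) ^ (-s) - (x : ℂ) ^ (-s)‖ ≤ ‖s‖ * a ^ (-s.re - 1) := by
  have hs0 : -s ≠ 0 := by
    intro h; simp [neg_eq_zero.1 h] at hs
  have h := (convex_Icc a (a + 1)).norm_image_sub_le_of_norm_hasDerivWithin_le
    (f := fun x : ℝ ↦ (x : ℂ) ^ (-s)) (f' := fun x : ℝ ↦ -s * (x : ℂ) ^ (-s - 1))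
    (C := ‖s‖ * a ^ (-s.re - 1))
    (fun z hz ↦ (hasDerivAt_ofReal_cpow_const (ha.trans_le hz.1).ne' hs0).hasDerivWithinAt)
    (fun z hz ↦ by
      rw [norm_mul, norm_neg, Complex.norm_cpow_eq_rpow_re_of_pos (ha.trans_le hz.1)]
      refine mul_le_mul_of_nonneg_left ?_ (norm_nonneg _)
      simp only [Complex.sub_re, Complex.neg_re, Complex.one_re]
      exact Real.rpow_le_rpow_of_nonpos ha hz.1 (by linarith)) hx hy
  refine h.trans (mul_le_of_le_one_right (by positivity) ?_)
  rw [Real.norm_eq_abs, abs_le]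
  constructor <;> linarith [hx.1, hx.2, hy.1, hy.2]

lemma norm_zetaTerm_le {n : ℕ} (hn : 0 < n) {s : ℂ} (hs : 0 < s.re) :
    ‖zetaTerm n s‖ ≤ ‖s - 1‖ * ‖s‖ * (n : ℝ) ^ (-s.re - 1) := by
  have hn' : (0 : ℝ) < n := by exact_mod_cast hn
  by_cases h1 : s = 1
  · simp [h1, zetaTerm]
  have h1' : 1 - s ≠ 0 := sub_ne_zero.2 (Ne.symm h1)
  have hmem : (n : ℝ) + 1 ∈ Set.Icc (n : ℝ) (n + 1) := ⟨by linarith, le_rfl⟩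
  have h := (convex_Icc (n : ℝ) (n + 1)).norm_image_sub_le_of_norm_hasDerivWithin_le
    (f := fun x : ℝ ↦ (s - 1) * ((n : ℂ) + 1) ^ (-s) * (x : ℂ) + (x : ℂ) ^ (1 - s))
    (f' := fun x : ℝ ↦ (s - 1) * ((n : ℂ) + 1) ^ (-s) * 1 + (1 - s) * (x : ℂ) ^ (1 - s - 1))
    (C := ‖s - 1‖ * ‖s‖ * (n : ℝ) ^ (-s.re - 1)) (x := n) (y := n + 1)
    (fun z hz ↦ ((Complex.ofRealCLM.hasDerivAt.const_mul _).add
      (hasDerivAt_ofReal_cpow_const (hn'.trans_le hz.1).ne' h1')).hasDerivWithinAt)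
    (fun z hz ↦ by
      have e : (s - 1) * ((n : ℂ) + 1) ^ (-s) * 1 + (1 - s) * (z : ℂ) ^ (1 - s - 1) =
          (s - 1) * ((((n : ℝ) + 1 : ℝ) : ℂ) ^ (-s) - (z : ℂ) ^ (-s)) := by
        rw [show 1 - s - 1 = -s by ring]
        push_cast
        ring
      rw [e, norm_mul, mul_assoc]
      exact mul_le_mul_of_nonneg_left (norm_cpow_neg_sub_le hn' hs hz hmem) (norm_nonneg _))
    ⟨le_rfl, by linarith⟩ hmem
  convert! h using 1
  · rw [zetaTerm]
    push_cast
    congr 1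
    ring
  · simp

lemma differentiable_zetaTerm {n : ℕ} (hn : 0 < n) : Differentiable ℂ (zetaTerm n) := by
  have h0 : (n : ℂ) ≠ 0 := by exact_mod_cast hn.ne'
  have h1 : (n : ℂ) + 1 ≠ 0 := by exact_mod_cast n.succ_ne_zero
  intro s
  unfold zetaTerm
  have hc (c : ℂ) (hc : c ≠ 0) (f : ℂ → ℂ) (hf : DifferentiableAt ℂ f s) :
      DifferentiableAt ℂ (fun s ↦ c ^ f s) s := hf.const_cpow (Or.inl hc)
  exact ((by fun_prop : DifferentiableAt ℂ (fun s : ℂ ↦ s - 1) s).mul (hc _ h1 _ (by fun_prop))).add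
    ((hc _ h1 _ (by fun_prop)).sub (hc _ h0 _ (by fun_prop)))

lemma summable_add_rpow_neg {N : ℕ} {p : ℝ} (hp : p < -1) :
    Summable fun n : ℕ ↦ ((n + N : ℕ) : ℝ) ^ p :=
  (summable_nat_add_iff N).2 (Real.summable_nat_rpow.2 hp)

lemma summable_zetaTerm {N : ℕ} (hN : 0 < N) {s : ℂ} (hs : 0 < s.re) :
    Summable fun n ↦ zetaTerm (n + N) s :=
  Summable.of_norm_bounded ((summable_add_rpow_neg (by linarith)).mul_left (‖s - 1‖ * ‖s‖))
    fun n ↦ norm_zetaTerm_le (by omega) hs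

/-- The truncated Dirichlet series of `(s - 1) ζ(s)` with its Euler-Maclaurin remainder. -/
noncomputable def zetaExpansion (N : ℕ) (s : ℂ) : ℂ :=
  (s - 1) * ∑ n ∈ Finset.range N, ((n : ℂ) + 1) ^ (-s) + (N : ℂ) ^ (1 - s) +
    ∑' n, zetaTerm (n + N) s

lemma zetaRegular_eq_zetaExpansion_of_one_lt_re {N : ℕ} (hN : 0 < N) {s : ℂ} (hs : 1 < s.re) :
    zetaRegular s = zetaExpansion N s := by
  have h1 : s ≠ 1 := by rintro rfl; simp at hs
  have hsum : Summable fun n : ℕ ↦ ((n : ℂ) + 1) ^ (-s) := by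
    have := (summable_nat_add_iff 1).2 (Complex.summable_one_div_nat_cpow.2 hs)
    refine this.congr fun n ↦ ?_
    rw [Complex.cpow_neg]
    push_cast
    simp
  have hz : riemannZeta s = ∑' n : ℕ, ((n : ℂ) + 1) ^ (-s) := by
    rw [zeta_eq_tsum_one_div_nat_add_one_cpow hs]
    simp [Complex.cpow_neg]
  have hlim : Tendsto (fun m : ℕ ↦ ((m + N : ℕ) : ℂ) ^ (1 - s)) atTop (nhds 0) := by
    rw [tendsto_zero_iff_norm_tendsto_zero]
    have : Tendsto (fun m : ℕ ↦ ((m + N : ℕ) : ℝ) ^ (-(s.re - 1))) atTop (nhds 0) :=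
      (tendsto_rpow_neg_atTop (by linarith)).comp
        (tendsto_natCast_atTop_atTop.comp (tendsto_add_atTop_nat N))
    refine this.congr fun m ↦ ?_
    rw [Complex.norm_natCast_cpow_of_pos (by omega)]
    congr 1
    simp
  have hpart (m : ℕ) : ∑ n ∈ Finset.range m, zetaTerm (n + N) s =
      (s - 1) * ∑ n ∈ Finset.range m, (((n + N : ℕ) : ℂ) + 1) ^ (-s) +
        (((m + N : ℕ) : ℂ) ^ (1 - s) - (N : ℂ) ^ (1 - s)) := by
    have ht := Finset.sum_range_sub (fun n : ℕ ↦ ((n + N : ℕ) : ℂ) ^ (1 - s)) m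
    simp only [zero_add] at ht
    rw [← ht, Finset.mul_sum, ← Finset.sum_add_distrib]
    refine Finset.sum_congr rfl fun n _ ↦ ?_
    rw [zetaTerm]
    congr 3
    push_cast
    ring
  have hT : ∑' n, zetaTerm (n + N) s =
      (s - 1) * ∑' n : ℕ, (((n + N : ℕ) : ℂ) + 1) ^ (-s) - (N : ℂ) ^ (1 - s) := by
    refine tendsto_nhds_unique (summable_zetaTerm hN (by linarith)).hasSum.tendsto_sum_nat ?_
    simp_rw [hpart]
    have := ((((summable_nat_add_iff N).2 hsum).hasSum.tendsto_sum_nat).const_mul (s - 1)).add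
      (hlim.sub_const ((N : ℂ) ^ (1 - s)))
    convert! this using 2
    ring
  rw [zetaRegular_of_ne h1, zetaExpansion, hT, hz, ← hsum.sum_add_tsum_nat_add N]
  ring

lemma differentiableAt_zetaExpansion {N : ℕ} (hN : 0 < N) {s : ℂ} (hs : 0 < s.re) :
    DifferentiableAt ℂ (zetaExpansion N) s := by
  have hfin : Differentiable ℂ fun s : ℂ ↦
      (s - 1) * ∑ n ∈ Finset.range N, ((n : ℂ) + 1) ^ (-s) + (N : ℂ) ^ (1 - s) := by
    intro z
    have hc (c : ℂ) (hc : c ≠ 0) (f : ℂ → ℂ) (hf : DifferentiableAt ℂ f z) :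
        DifferentiableAt ℂ (fun s ↦ c ^ f s) z := hf.const_cpow (Or.inl hc)
    refine ((by fun_prop : DifferentiableAt ℂ (fun s : ℂ ↦ s - 1) z).mul ?_).add
      (hc _ (by exact_mod_cast hN.ne') _ (by fun_prop))
    exact DifferentiableAt.fun_sum fun n _ ↦ hc _ (by exact_mod_cast n.succ_ne_zero) _ (by fun_prop)
  refine (hfin s).add ?_
  let U : Set ℂ := {z | s.re / 2 < z.re} ∩ Metric.ball 0 (‖s‖ + 1)
  have hU : IsOpen U := (isOpen_lt continuous_const Complex.continuous_re).inter Metric.isOpen_ball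
  have hsU : s ∈ U := ⟨by show s.re / 2 < s.re; linarith, by simp⟩
  refine (Complex.differentiableOn_tsum_of_summable_norm
    ((summable_add_rpow_neg (N := N) (p := -(s.re / 2) - 1) (by linarith)).mul_left
      ((‖s‖ + 1 + 1) * (‖s‖ + 1)))
    (fun n ↦ (differentiable_zetaTerm (by omega)).differentiableOn) hU
    (fun n w hw ↦ ?_)).differentiableAt (hU.mem_nhds hsU)
  have hw1 : s.re / 2 < w.re := hw.1
  have hw2 : ‖w‖ < ‖s‖ + 1 := by simpa using hw.2
  refine (norm_zetaTerm_le (by omega) (by linarith)).trans ?_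
  have : ‖w - 1‖ ≤ ‖s‖ + 1 + 1 := (norm_sub_le _ _).trans (by simp; linarith)
  have h1 : (1 : ℝ) ≤ (n + N : ℕ) := by exact_mod_cast (by omega : 1 ≤ n + N)
  gcongr

lemma zetaRegular_eq_zetaExpansion {N : ℕ} (hN : 0 < N) {s : ℂ} (hs : 0 < s.re) :
    zetaRegular s = zetaExpansion N s := by
  have hopen : IsOpen {z : ℂ | 0 < z.re} := isOpen_lt continuous_const Complex.continuous_re
  refine AnalyticOnNhd.eqOn_of_preconnected_of_eventuallyEq (U := {z : ℂ | 0 < z.re}) (z₀ := 2)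
    (differentiable_zetaRegular.differentiableOn.analyticOnNhd hopen)
    (DifferentiableOn.analyticOnNhd (fun z hz ↦
      (differentiableAt_zetaExpansion hN hz).differentiableWithinAt) hopen)
    (convex_halfSpace_re_gt 0).isPreconnected (by simp) ?_ hs
  filter_upwards [(isOpen_lt continuous_const Complex.continuous_re).mem_nhds
    (show (2 : ℂ) ∈ {z : ℂ | 1 < z.re} by simp)] with z hz
  exact zetaRegular_eq_zetaExpansion_of_one_lt_re hN hz

/-- A convexity-type bound for `(s - 1) ζ(s)` near the line `Re s = 1`. -/
theorem exists_norm_zetaRegular_le {ε : ℝ} (hε : 0 < ε) (hε1 : ε ≤ 1 / 2) :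
    ∃ C, 0 < C ∧ ∀ s : ℂ, 1 - ε ≤ s.re → s.re ≤ 3 →
      ‖zetaRegular s‖ ≤ C * (1 + |s.im|) ^ (1 + 2 * ε) := by
  have hsum : Summable fun n : ℕ ↦ (n : ℝ) ^ (-(1 + ε)) := Real.summable_nat_rpow.2 (by linarith)
  set c : ℝ := ∑' n : ℕ, (n : ℝ) ^ (-(1 + ε)) with hc
  have hc0 : 0 ≤ c := tsum_nonneg fun n ↦ by positivity
  refine ⟨4 * (2 ^ (2 * ε) * c) + 2 ^ (2 * ε) + 4 * 4 * (2 ^ (2 * ε) * c), by positivity,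
    fun s hs1 hs3 ↦ ?_⟩
  set τ : ℝ := 1 + |s.im| with hτ
  have hτ1 : 1 ≤ τ := by simp [hτ]
  set N : ℕ := ⌈τ⌉₊ with hNdef
  have hN1 : τ ≤ N := Nat.le_ceil τ
  have hN2 : (N : ℝ) ≤ 2 * τ := by linarith [Nat.ceil_lt_add_one (by linarith : 0 ≤ τ)]
  have hN0 : 0 < N := by
    have : (0 : ℝ) < N := by linarith
    exact_mod_cast this
  have hN0' : (1 : ℝ) ≤ N := by exact_mod_cast hN0
  have hs0 : 0 < s.re := by linarith
  have hre : |s.re| ≤ 3 := abs_le.2 ⟨by linarith, hs3⟩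
  have hre' : |s.re - 1| ≤ 3 := abs_le.2 ⟨by linarith, by linarith⟩
  have hns : ‖s‖ ≤ 4 * τ := (Complex.norm_le_abs_re_add_abs_im s).trans (by
    have := abs_nonneg s.im
    linarith)
  have hns1 : ‖s - 1‖ ≤ 4 * τ := (Complex.norm_le_abs_re_add_abs_im (s - 1)).trans (by
    have := abs_nonneg s.im
    simp only [Complex.sub_re, Complex.one_re, Complex.sub_im, Complex.one_im, sub_zero]
    linarith)
  have hpow : (N : ℝ) ^ (2 * ε) ≤ 2 ^ (2 * ε) * τ ^ (2 * ε) := by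
    rw [← Real.mul_rpow (by norm_num) (by linarith)]
    exact Real.rpow_le_rpow (by linarith) hN2 (by linarith)
  have hA : ‖∑ n ∈ Finset.range N, ((n : ℂ) + 1) ^ (-s)‖ ≤ (N : ℝ) ^ (2 * ε) * c := by
    refine (norm_sum_le _ _).trans ?_
    have hterm : ∀ n ∈ Finset.range N, ‖((n : ℂ) + 1) ^ (-s)‖ ≤
        (N : ℝ) ^ (2 * ε) * ((n + 1 : ℕ) : ℝ) ^ (-(1 + ε)) := by
      intro n hn
      have hn1 : (1 : ℝ) ≤ (n + 1 : ℕ) := by exact_mod_cast (by omega : 1 ≤ n + 1)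
      have hnN : ((n + 1 : ℕ) : ℝ) ≤ N := by
        exact_mod_cast Nat.succ_le_of_lt (Finset.mem_range.1 hn)
      have e : ((n : ℂ) + 1) ^ (-s) = ((n + 1 : ℕ) : ℂ) ^ (-s) := by push_cast; rfl
      rw [e, Complex.norm_natCast_cpow_of_pos (by omega), Complex.neg_re]
      calc ((n + 1 : ℕ) : ℝ) ^ (-s.re) ≤ ((n + 1 : ℕ) : ℝ) ^ (2 * ε + -(1 + ε)) :=
            Real.rpow_le_rpow_of_exponent_le hn1 (by linarith)
        _ = ((n + 1 : ℕ) : ℝ) ^ (2 * ε) * ((n + 1 : ℕ) : ℝ) ^ (-(1 + ε)) :=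
            Real.rpow_add (by linarith) _ _
        _ ≤ _ := by gcongr
    refine (Finset.sum_le_sum hterm).trans ?_
    rw [← Finset.mul_sum]
    gcongr
    have h2 := (summable_nat_add_iff 1).2 hsum
    refine (h2.sum_le_tsum _ fun n _ ↦ by positivity).trans ?_
    have := hsum.sum_add_tsum_nat_add 1
    rw [hc, ← this]
    simp only [Finset.range_one, Finset.sum_singleton, le_add_iff_nonneg_left]
    positivity
  have hB : ‖(N : ℂ) ^ (1 - s)‖ ≤ (N : ℝ) ^ (2 * ε) := by
    rw [Complex.norm_natCast_cpow_of_pos hN0]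
    exact Real.rpow_le_rpow_of_exponent_le hN0' (by simp; linarith)
  have hD : ‖∑' n, zetaTerm (n + N) s‖ ≤ ‖s - 1‖ * ‖s‖ * ((N : ℝ) ^ (2 * ε - 1) * c) := by
    have h2 := (summable_nat_add_iff N).2 hsum
    have hle (n : ℕ) : ‖zetaTerm (n + N) s‖ ≤
        ‖s - 1‖ * ‖s‖ * ((N : ℝ) ^ (2 * ε - 1) * ((n + N : ℕ) : ℝ) ^ (-(1 + ε))) := by
      refine (norm_zetaTerm_le (by omega) hs0).trans ?_
      have hn1 : (1 : ℝ) ≤ (n + N : ℕ) := by exact_mod_cast (by omega : 1 ≤ n + N)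
      have hnN : (N : ℝ) ≤ (n + N : ℕ) := by exact_mod_cast (by omega : N ≤ n + N)
      gcongr
      calc ((n + N : ℕ) : ℝ) ^ (-s.re - 1) ≤ ((n + N : ℕ) : ℝ) ^ ((2 * ε - 1) + -(1 + ε)) :=
            Real.rpow_le_rpow_of_exponent_le hn1 (by linarith)
        _ = ((n + N : ℕ) : ℝ) ^ (2 * ε - 1) * ((n + N : ℕ) : ℝ) ^ (-(1 + ε)) :=
            Real.rpow_add (by linarith) _ _
        _ ≤ _ := by
            gcongr ?_ * _
            exact Real.rpow_le_rpow_of_nonpos (by linarith) hnN (by linarith)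
    refine (tsum_of_norm_bounded ((h2.mul_left _).mul_left _).hasSum hle).trans ?_
    rw [tsum_mul_left, tsum_mul_left]
    gcongr
    rw [hc, ← hsum.sum_add_tsum_nat_add N]
    simp only [le_add_iff_nonneg_left]
    exact Finset.sum_nonneg fun n _ ↦ by positivity
  have hpow' : (N : ℝ) ^ (2 * ε - 1) ≤ 2 ^ (2 * ε) * τ ^ (2 * ε) / τ := by
    rw [Real.rpow_sub_one (by linarith)]
    gcongr
  rw [zetaRegular_eq_zetaExpansion hN0 hs0, zetaExpansion, Real.rpow_add (by linarith),
    Real.rpow_one]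
  set P : ℝ := τ ^ (2 * ε) with hP
  set Q : ℝ := 2 ^ (2 * ε) with hQ
  have hP0 : 0 < P := by positivity
  have hQ0 : 0 < Q := by positivity
  calc _ ≤ ‖s - 1‖ * ‖∑ n ∈ Finset.range N, ((n : ℂ) + 1) ^ (-s)‖ + ‖(N : ℂ) ^ (1 - s)‖ +
        ‖∑' n, zetaTerm (n + N) s‖ := by
        rw [← norm_mul]
        exact norm_add₃_le
    _ ≤ 4 * τ * (Q * P * c) + Q * P + 4 * τ * (4 * τ) * (Q * P / τ * c) := by
        refine add_le_add (add_le_add ?_ (hB.trans hpow)) (hD.trans ?_)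
        · exact mul_le_mul hns1 (hA.trans (by gcongr)) (norm_nonneg _) (by linarith)
        · gcongr
    _ = (4 * (Q * c) + 4 * 4 * (Q * c)) * (τ * P) + Q * P := by
        field_simp
        ring
    _ ≤ (4 * (Q * c) + 4 * 4 * (Q * c)) * (τ * P) + Q * (τ * P) := by
        gcongr
        exact le_mul_of_one_le_left hP0.le hτ1
    _ = _ := by ring

lemma exists_norm_zetaRegular_le_mul_rpow :
    ∃ C, 0 < C ∧ ∀ s : ℂ, 1 - 1 / 120 ≤ s.re → s.re ≤ 3 →
      ‖zetaRegular s‖ ≤ C * ((1 + |s.im|) * (1 + |s.im|) ^ (1 / 60 : ℝ)) := by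
  obtain ⟨C, hC, h⟩ := exists_norm_zetaRegular_le (ε := 1 / 120) (by norm_num) (by norm_num)
  refine ⟨C, hC, fun s h1 h3 ↦ (h s h1 h3).trans_eq ?_⟩
  have : 0 < 1 + |s.im| := by positivity
  rw [Real.rpow_add this, Real.rpow_one]
  norm_num

lemma mul_rpow_le_four_mul {x τ : ℝ} (hx : 0 < x) (hxτ : x ≤ 2 * τ) :
    x * x ^ (1 / 60 : ℝ) ≤ 4 * (τ * τ ^ (1 / 60 : ℝ)) := by
  have hτ : 0 < τ := by linarith
  have h2 : (2 : ℝ) ^ (1 / 60 : ℝ) ≤ 2 := by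
    simpa using Real.rpow_le_rpow_of_exponent_le (x := 2) (by norm_num)
      (by norm_num : (1 / 60 : ℝ) ≤ 1)
  calc x * x ^ (1 / 60 : ℝ) ≤ (2 * τ) * (2 * τ) ^ (1 / 60 : ℝ) := by gcongr
    _ = (2 * τ) * (2 ^ (1 / 60 : ℝ) * τ ^ (1 / 60 : ℝ)) := by
        rw [Real.mul_rpow (by norm_num) hτ.le]
    _ ≤ (2 * τ) * (2 * τ ^ (1 / 60 : ℝ)) := by gcongr
    _ = _ := by ring

lemma exists_norm_iteratedDeriv_zetaRegular_le (j : ℕ) :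
    ∃ C, 0 < C ∧ ∀ s : ℂ, 1 ≤ s.re → s.re ≤ 2 →
      ‖iteratedDeriv j zetaRegular s‖ ≤ C * ((1 + |s.im|) * (1 + |s.im|) ^ (1 / 60 : ℝ)) := by
  obtain ⟨C, hC, h⟩ := exists_norm_zetaRegular_le_mul_rpow
  refine ⟨j.factorial * (C * 4) / (1 / 120) ^ j, by positivity, fun s h1 h2 ↦ ?_⟩
  have := Complex.norm_iteratedDeriv_le_of_forall_mem_sphere_norm_le (c := s) (R := 1 / 120)
    (C := C * (4 * ((1 + |s.im|) * (1 + |s.im|) ^ (1 / 60 : ℝ)))) j (by norm_num)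
    differentiable_zetaRegular.diffContOnCl (fun z hz ↦ by
      have hz' : ‖z - s‖ = 1 / 120 := by simpa [dist_eq_norm] using hz
      have hr := abs_le.1 ((Complex.abs_re_le_norm (z - s)).trans_eq hz')
      have hi := (Complex.abs_im_le_norm (z - s)).trans_eq hz'
      simp only [Complex.sub_re, Complex.sub_im] at hr hi
      refine (h z (by linarith [hr.1]) (by linarith [hr.2])).trans ?_
      refine mul_le_mul_of_nonneg_left (mul_rpow_le_four_mul (by positivity) ?_) hC.le
      have := abs_sub_abs_le_abs_sub z.im s.im
      linarith [abs_nonneg s.im])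
  refine this.trans_eq ?_
  ring

lemma one_le_norm_riemannZeta_product {x : ℝ} (hx : 0 < x) (y : ℝ) :
    1 ≤ ‖riemannZeta (1 + x)‖ ^ 3 * ‖riemannZeta (1 + x + Complex.I * y)‖ ^ 4 *
      ‖riemannZeta (1 + x + 2 * Complex.I * y)‖ := by
  have := DirichletCharacter.norm_LFunction_product_ge_one (1 : DirichletCharacter ℂ 1) hx y
  simpa [DirichletCharacter.LFunctionTrivChar, DirichletCharacter.LFunction_modOne_eq] using this

lemma norm_zetaRegular_product_ge {x : ℝ} (hx : 0 < x) {y : ℝ} (hy : 1 ≤ |y|) :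
    x ^ 3 * (1 + |y|) ^ 5 / 16 ≤
      ‖zetaRegular (1 + x)‖ ^ 3 * ‖zetaRegular (1 + x + Complex.I * y)‖ ^ 4 *
      ‖zetaRegular (1 + x + 2 * Complex.I * y)‖ := by
  have hne (z : ℂ) (hz : z.re = 1 + x) : z ≠ 1 := by
    rintro rfl
    simp at hz
    linarith
  rw [zetaRegular_of_ne (hne _ (by simp)), zetaRegular_of_ne (hne _ (by simp)),
    zetaRegular_of_ne (hne _ (by simp))]
  simp only [norm_mul]
  have e1 : ‖(1 + x - 1 : ℂ)‖ = x := by simp [abs_of_pos hx]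
  have e2 : |y| ≤ ‖(1 + x + Complex.I * y - 1 : ℂ)‖ := by
    simpa using Complex.abs_im_le_norm (1 + x + Complex.I * y - 1 : ℂ)
  have e3 : 2 * |y| ≤ ‖(1 + x + 2 * Complex.I * y - 1 : ℂ)‖ := by
    simpa using Complex.abs_im_le_norm (1 + x + 2 * Complex.I * y - 1 : ℂ)
  rw [e1]
  have hp := one_le_norm_riemannZeta_product hx y
  set a := ‖riemannZeta (1 + x)‖
  set b := ‖riemannZeta (1 + x + Complex.I * y)‖
  set c := ‖riemannZeta (1 + x + 2 * Complex.I * y)‖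
  set p := ‖(1 + x + Complex.I * y - 1 : ℂ)‖
  set r := ‖(1 + x + 2 * Complex.I * y - 1 : ℂ)‖
  have hp' : (1 + |y|) / 2 ≤ p := by linarith
  have hr' : 1 + |y| ≤ r := by linarith
  calc x ^ 3 * (1 + |y|) ^ 5 / 16 = x ^ 3 * ((1 + |y|) / 2) ^ 4 * (1 + |y|) * 1 := by ring
    _ ≤ x ^ 3 * p ^ 4 * r * (a ^ 3 * b ^ 4 * c) := by gcongr
    _ = _ := by ring

lemma zetaRegular_pow_four_ge : ∃ d, 0 < d ∧ ∀ s : ℂ, 1 < s.re → s.re ≤ 2 → 1 ≤ |s.im| →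
    d ^ 4 * (s.re - 1) ^ 3 * (1 + |s.im|) ^ 4 ≤
      (1 + |s.im|) ^ (1 / 60 : ℝ) * ‖zetaRegular s‖ ^ 4 := by
  obtain ⟨K, hK, h⟩ := exists_norm_zetaRegular_le_mul_rpow
  refine ⟨1 / (3 * K), by positivity, fun s h1 h2 ht ↦ ?_⟩
  have hp := norm_zetaRegular_product_ge (x := s.re - 1) (by linarith) ht
  have e0 : (1 + ((s.re - 1 : ℝ) : ℂ)) = (s.re : ℂ) := by push_cast; ring
  have e1 : (s.re : ℂ) + Complex.I * s.im = s := by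
    rw [mul_comm]
    exact Complex.re_add_im s
  rw [e0, e1] at hp
  set τ : ℝ := 1 + |s.im| with hτ
  have hτ0 : 0 < τ := by positivity
  have b1 : ‖zetaRegular (s.re : ℂ)‖ ≤ K := by
    simpa using h (s.re : ℂ) (by simp; linarith) (by simp; linarith)
  have b2 : ‖zetaRegular ((s.re : ℂ) + 2 * Complex.I * s.im)‖ ≤
      K * (4 * (τ * τ ^ (1 / 60 : ℝ))) := by
    refine (h _ (by simp; linarith) (by simp; linarith)).trans ?_
    refine mul_le_mul_of_nonneg_left (mul_rpow_le_four_mul (by positivity) ?_) hK.le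
    simp [abs_mul]
    linarith
  set P : ℝ := τ ^ (1 / 60 : ℝ) with hP
  have hP0 : 0 < P := by positivity
  have hfin : (s.re - 1) ^ 3 * τ ^ 5 / 16 ≤
      K ^ 3 * ‖zetaRegular s‖ ^ 4 * (K * (4 * (τ * P))) := by
    refine hp.trans ?_
    gcongr
  have hfin' : (s.re - 1) ^ 3 * τ ^ 4 ≤ 64 * K ^ 4 * (P * ‖zetaRegular s‖ ^ 4) := by
    refine le_of_mul_le_mul_right ?_ hτ0
    linarith
  calc (1 / (3 * K)) ^ 4 * (s.re - 1) ^ 3 * τ ^ 4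
      = ((s.re - 1) ^ 3 * τ ^ 4) * (1 / (81 * K ^ 4)) := by field_simp; ring
    _ ≤ (64 * K ^ 4 * (P * ‖zetaRegular s‖ ^ 4)) * (1 / (81 * K ^ 4)) := by gcongr
    _ = 64 / 81 * (P * ‖zetaRegular s‖ ^ 4) := by field_simp
    _ ≤ P * ‖zetaRegular s‖ ^ 4 := mul_le_of_le_one_left (by positivity) (by norm_num)

lemma norm_zetaRegular_horizontal_sub_le : ∃ C, 0 < C ∧ ∀ a b t : ℝ, a ∈ Set.Icc 1 2 →
    b ∈ Set.Icc 1 2 → ‖zetaRegular ⟨a, t⟩ - zetaRegular ⟨b, t⟩‖ ≤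
      C * ((1 + |t|) * (1 + |t|) ^ (1 / 60 : ℝ)) * |a - b| := by
  obtain ⟨C, hC, h⟩ := exists_norm_iteratedDeriv_zetaRegular_le 1
  refine ⟨C, hC, fun a b t ha hb ↦ ?_⟩
  have hconv : Convex ℝ (Set.Icc (1 : ℝ) 2 ×ℂ {t}) :=
    ((convex_Icc (1 : ℝ) 2).is_linear_preimage Complex.reLm.isLinear).inter
      ((convex_singleton t).is_linear_preimage Complex.imLm.isLinear)
  have := hconv.norm_image_sub_le_of_norm_deriv_le
    (f := zetaRegular) (C := C * ((1 + |t|) * (1 + |t|) ^ (1 / 60 : ℝ))) (x := ⟨b, t⟩) (y := ⟨a, t⟩)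
    (fun z _ ↦ differentiable_zetaRegular z) (fun z hz ↦ by
      have hz1 : z.re ∈ Set.Icc (1 : ℝ) 2 := hz.1
      have hz2 : z.im = t := hz.2
      have := h z hz1.1 hz1.2
      rwa [hz2, iteratedDeriv_one] at this) ⟨hb, rfl⟩ ⟨ha, rfl⟩
  refine this.trans_eq ?_
  congr 1
  rw [show (⟨a, t⟩ - ⟨b, t⟩ : ℂ) = ((a - b : ℝ) : ℂ) by apply Complex.ext <;> simp,
    Complex.norm_real, Real.norm_eq_abs]

/-- A lower bound for `(s - 1) ζ(s)` to the right of the line `Re s = 1`. -/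
theorem exists_le_norm_zetaRegular : ∃ c, 0 < c ∧ ∀ s : ℂ, 1 < s.re → s.re ≤ 2 →
    c * (1 + |s.im|) ≤ ‖zetaRegular s‖ * ((1 + |s.im|) ^ (1 / 60 : ℝ)) ^ 4 := by
  obtain ⟨d, hd, h4⟩ := zetaRegular_pow_four_ge
  obtain ⟨C, hC, hh⟩ := norm_zetaRegular_horizontal_sub_le
  obtain ⟨m, hm, hmin⟩ : ∃ m, 0 < m ∧ ∀ s : ℂ, 1 < s.re → s.re ≤ 2 → |s.im| ≤ 1 →
      m ≤ ‖zetaRegular s‖ := by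
    have hcomp : IsCompact (Set.Icc (1 : ℝ) 2 ×ℂ Set.Icc (-1) 1) := isCompact_Icc.reProdIm isCompact_Icc
    obtain ⟨z, hz, hzmin⟩ := hcomp.exists_isMinOn ⟨⟨1, 0⟩, by simp [Complex.mem_reProdIm]⟩
      differentiable_zetaRegular.continuous.norm.continuousOn
    have hz1 : z.re ∈ Set.Icc (1 : ℝ) 2 := hz.1
    refine ⟨_, norm_pos_iff.2 (zetaRegular_ne_zero hz1.1), fun s h1 h2 ht ↦ ?_⟩
    exact hzmin ⟨⟨h1.le, h2⟩, abs_le.1 ht⟩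
  set e : ℝ := min 1 (d / (2 * C)) with he
  have he0 : 0 < e := by positivity
  have he1 : e ≤ 1 := min_le_left _ _
  have heC : C * e ≤ d / 2 := by
    calc C * e ≤ C * (d / (2 * C)) := by gcongr; exact min_le_right _ _
      _ = d / 2 := by field_simp
  refine ⟨min (m / 2) (d * e ^ 3 / 2), by positivity, fun s h1 h2 ↦ ?_⟩
  set τ : ℝ := 1 + |s.im| with hτ
  have hτ1 : 1 ≤ τ := by simp [hτ]
  set P : ℝ := τ ^ (1 / 60 : ℝ) with hP
  have hP1 : 1 ≤ P := Real.one_le_rpow hτ1 (by norm_num)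
  rcases le_total (|s.im|) 1 with ht | ht
  · calc min (m / 2) (d * e ^ 3 / 2) * τ ≤ (m / 2) * 2 := by
          gcongr
          · exact min_le_left _ _
          · linarith
      _ = m * 1 ^ 4 := by ring
      _ ≤ ‖zetaRegular s‖ * P ^ 4 := by
          gcongr
          exact hmin s h1 h2 ht
  -- away from the line `Re s = 1` the product inequality suffices
  have hfar (σ : ℝ) (hσ : 1 + e ^ 4 / P ^ 5 ≤ σ) (hσ2 : σ ≤ 2) :
      d * e ^ 3 * τ ≤ ‖zetaRegular ⟨σ, s.im⟩‖ * P ^ 4 := by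
    have hpos : 0 < e ^ 4 / P ^ 5 := by positivity
    have := h4 ⟨σ, s.im⟩ (by show 1 < σ; linarith) hσ2 ht
    simp only [← hτ, ← hP] at this
    refine (pow_le_pow_iff_left₀ (by positivity) (by positivity) (by norm_num : 4 ≠ 0)).1 ?_
    calc (d * e ^ 3 * τ) ^ 4 = d ^ 4 * (e ^ 4 / P ^ 5) ^ 3 * τ ^ 4 * P ^ 15 := by field_simp
      _ ≤ d ^ 4 * (σ - 1) ^ 3 * τ ^ 4 * P ^ 15 := by
          gcongr
          linarith
      _ ≤ P * ‖zetaRegular ⟨σ, s.im⟩‖ ^ 4 * P ^ 15 := by gcongr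
      _ = _ := by ring
  have hmain : d * e ^ 3 / 2 * τ ≤ ‖zetaRegular s‖ * P ^ 4 := by
    rcases le_total (1 + e ^ 4 / P ^ 5) s.re with hσ | hσ
    · refine le_trans ?_ (hfar s.re hσ h2)
      gcongr
      linarith [show 0 < d * e ^ 3 by positivity]
    · have hle : e ^ 4 / P ^ 5 ≤ 1 :=
        div_le_one_of_le₀ ((pow_le_one₀ he0.le he1).trans (one_le_pow₀ hP1)) (by positivity)
      have hf := hfar (1 + e ^ 4 / P ^ 5) le_rfl (by linarith)
      have hb := hh (1 + e ^ 4 / P ^ 5) s.re s.im ⟨by simp; positivity, by linarith⟩ ⟨h1.le, h2⟩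
      rw [← hτ, ← hP, abs_of_nonneg (by linarith)] at hb
      have hb' : ‖zetaRegular ⟨1 + e ^ 4 / P ^ 5, s.im⟩ - zetaRegular s‖ ≤
          C * (τ * P) * (e ^ 4 / P ^ 5) := hb.trans (by gcongr; linarith)
      have htri := norm_sub_norm_le (zetaRegular ⟨1 + e ^ 4 / P ^ 5, s.im⟩) (zetaRegular s)
      have hx : (‖zetaRegular ⟨1 + e ^ 4 / P ^ 5, s.im⟩‖ - ‖zetaRegular s‖) * P ^ 4 ≤
          C * (τ * P) * (e ^ 4 / P ^ 5) * P ^ 4 := by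
        gcongr
        exact htri.trans hb'
      have hy : C * (τ * P) * (e ^ 4 / P ^ 5) * P ^ 4 = (C * e) * (e ^ 3 * τ) := by field_simp
      have hz : (C * e) * (e ^ 3 * τ) ≤ d / 2 * (e ^ 3 * τ) := by gcongr
      linarith
  refine le_trans ?_ hmain
  gcongr
  exact min_le_right _ _

/-- The normalized derivatives `Z⁽ʲ⁾ / Z` of `Z(s) = (s - 1) ζ(s)`. -/
noncomputable def zetaRatio (j : ℕ) (s : ℂ) : ℂ := iteratedDeriv j zetaRegular s / zetaRegular s

lemma hasDerivAt_zetaRatio (j : ℕ) {s : ℂ} (hs : 1 ≤ s.re) :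
    HasDerivAt (zetaRatio j) (zetaRatio (j + 1) s - zetaRatio j s * zetaRatio 1 s) s := by
  have hZ := zetaRegular_ne_zero hs
  have h0 : HasDerivAt zetaRegular (iteratedDeriv 1 zetaRegular s) s := by
    rw [iteratedDeriv_one]
    exact (differentiable_zetaRegular s).hasDerivAt
  have hj : HasDerivAt (iteratedDeriv j zetaRegular) (iteratedDeriv (j + 1) zetaRegular s) s := by
    rw [iteratedDeriv_succ]
    exact ((differentiable_zetaRegular.contDiff (n := (j + 1 : ℕ))).differentiable_iteratedDeriv j
      (by exact_mod_cast j.lt_succ_self) s).hasDerivAt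
  convert! hj.div h0 hZ using 1
  simp only [zetaRatio]
  field_simp

lemma exists_norm_zetaRatio_le (j : ℕ) : ∃ C, 0 < C ∧ ∀ s : ℂ, 1 < s.re → s.re ≤ 2 →
    ‖zetaRatio j s‖ ≤ C * (1 + |s.im|) ^ (1 / 12 : ℝ) := by
  obtain ⟨C, hC, h⟩ := exists_norm_iteratedDeriv_zetaRegular_le j
  obtain ⟨c, hc, hl⟩ := exists_le_norm_zetaRegular
  refine ⟨C / c, by positivity, fun s h1 h2 ↦ ?_⟩
  have hu := h s h1.le h2
  have hlo := hl s h1 h2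
  set τ : ℝ := 1 + |s.im| with hτ
  have hτ0 : 0 < τ := by positivity
  have hp : τ ^ (1 / 12 : ℝ) = (τ ^ (1 / 60 : ℝ)) ^ 5 := by
    rw [← Real.rpow_mul_natCast hτ0.le]
    norm_num
  have hP0 : 0 < τ ^ (1 / 60 : ℝ) := by positivity
  rw [hp, zetaRatio, norm_div]
  set P := τ ^ (1 / 60 : ℝ)
  have hZ : 0 < ‖zetaRegular s‖ := norm_pos_iff.2 (zetaRegular_ne_zero h1.le)
  rw [div_le_iff₀ hZ]
  refine hu.trans ?_
  calc C * (τ * P) = C / c * P * (c * τ) := by field_simp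
    _ ≤ C / c * P * (‖zetaRegular s‖ * P ^ 4) := by gcongr
    _ = _ := by ring

/-- The Laplace transform of `ψ(eᵘ) e⁻ᵘ - 1`, expressed in the variable `s` of `ζ(s)`. -/
noncomputable def psiLaplace (s : ℂ) : ℂ := -(1 + zetaRatio 1 s) / s

lemma hasDerivAt_neg_div {F F' G : ℂ → ℂ} {s a : ℂ} (hs : s ≠ 0) (hF : HasDerivAt F (F' s) s)
    (hG : G s = -F s / s) (ha : a = G s) :
    HasDerivAt (fun z ↦ -F z / z) (-(F' s + a) / s) s := by
  convert! hF.neg.div (hasDerivAt_id s) hs using 1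
  simp only [id, ha, hG, Pi.neg_apply]
  field_simp
  ring

theorem exists_psiLaplace_derivatives : ∃ G₁ G₂ G₃ : ℂ → ℂ,
    (∀ s : ℂ, 1 < s.re → HasDerivAt psiLaplace (G₁ s) s ∧ HasDerivAt G₁ (G₂ s) s ∧
      HasDerivAt G₂ (G₃ s) s) ∧
    ∃ C, 0 < C ∧ ∀ s : ℂ, 1 < s.re → s.re ≤ 2 →
      ‖G₃ s‖ ≤ C * (1 + |s.im|) ^ (-(2 / 3) : ℝ) := by
  let R := zetaRatio
  let F₁ : ℂ → ℂ := fun s ↦ R 2 s - R 1 s * R 1 s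
  let F₂ : ℂ → ℂ := fun s ↦ R 3 s - 3 * (R 1 s * R 2 s) + 2 * (R 1 s * R 1 s * R 1 s)
  let F₃ : ℂ → ℂ := fun s ↦ R 4 s - R 3 s * R 1 s - 3 * ((R 2 s - R 1 s * R 1 s) * R 2 s) -
    3 * (R 1 s * (R 3 s - R 2 s * R 1 s)) + 6 * (R 1 s * R 1 s * (R 2 s - R 1 s * R 1 s))
  let G₁ : ℂ → ℂ := fun s ↦ -(F₁ s + psiLaplace s) / s
  let G₂ : ℂ → ℂ := fun s ↦ -(F₂ s + G₁ s + G₁ s) / s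
  let G₃ : ℂ → ℂ := fun s ↦ -(F₃ s + G₂ s + G₂ s + G₂ s) / s
  refine ⟨G₁, G₂, G₃, fun s hs ↦ ?_, ?_⟩
  · have hs0 : s ≠ 0 := by rintro rfl; simp at hs; linarith
    have hR (j : ℕ) := hasDerivAt_zetaRatio j hs.le
    have hF₀ : HasDerivAt (fun z ↦ 1 + R 1 z) (F₁ s) s := (hR 1).const_add 1
    have hF₁ : HasDerivAt F₁ (F₂ s) s := by
      convert! (hR 2).sub ((hR 1).mul (hR 1)) using 1
      simp only [F₂, R]
      ring
    have hF₂ : HasDerivAt F₂ (F₃ s) s := by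
      convert! ((hR 3).sub (((hR 1).mul (hR 2)).const_mul 3)).add
        ((((hR 1).mul (hR 1)).mul (hR 1)).const_mul 2) using 1
      simp only [F₃, R, Pi.mul_apply]
      ring
    have h0 : HasDerivAt psiLaplace (G₁ s) s :=
      hasDerivAt_neg_div (G := psiLaplace) hs0 hF₀ rfl rfl
    have h1 : HasDerivAt G₁ (G₂ s) s := by
      refine hasDerivAt_neg_div (F' := fun z ↦ F₂ z + G₁ z) (G := G₁) hs0 ?_ rfl rfl
      exact hF₁.add h0
    have h2 : HasDerivAt G₂ (G₃ s) s := by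
      refine hasDerivAt_neg_div (F' := fun z ↦ F₃ z + G₂ z + G₂ z) (G := G₂) hs0 ?_ rfl rfl
      exact (hF₂.add h1).add h1
    exact ⟨h0, h1, h2⟩
  · choose K hK hKb using exists_norm_zetaRatio_le
    set M : ℝ := 1 + K 1 + K 2 + K 3 + K 4 with hM
    have hK1 := hK 1
    have hK2 := hK 2
    have hK3 := hK 3
    have hK4 := hK 4
    have hM1 : 1 ≤ M := by linarith
    refine ⟨200 * M ^ 4, by positivity, fun s h1 h2 ↦ ?_⟩
    set τ : ℝ := 1 + |s.im| with hτ
    have hτ1 : 1 ≤ τ := by simp [hτ]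
    set p : ℝ := τ ^ (1 / 12 : ℝ) with hp
    have hp1 : 1 ≤ p := Real.one_le_rpow hτ1 (by norm_num)
    set b : ℝ := M * p with hb
    have hb1 : 1 ≤ b := one_le_mul_of_one_le_of_one_le hM1 hp1
    have hRb : ‖R 1 s‖ ≤ b ∧ ‖R 2 s‖ ≤ b ∧ ‖R 3 s‖ ≤ b ∧ ‖R 4 s‖ ≤ b := by
      refine ⟨?_, ?_, ?_, ?_⟩ <;> refine (hKb _ s h1 h2).trans ?_ <;>
        exact mul_le_mul_of_nonneg_right (by linarith) (by positivity)
    obtain ⟨r1, r2, r3, r4⟩ := hRb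
    have hns : 1 ≤ ‖s‖ := by
      have := (le_abs_self _).trans (Complex.abs_re_le_norm s)
      linarith
    have hns' : τ / 2 ≤ ‖s‖ := by
      have := Complex.abs_im_le_norm s
      linarith
    have hdiv (z : ℂ) : ‖-z / s‖ ≤ ‖z‖ := by
      rw [norm_div, norm_neg]
      exact div_le_self (norm_nonneg _) hns
    have m2 {x y : ℂ} {a c : ℝ} (hx : ‖x‖ ≤ a) (hy : ‖y‖ ≤ c) : ‖x * y‖ ≤ a * c := by
      rw [norm_mul]
      exact mul_le_mul hx hy (norm_nonneg _) ((norm_nonneg _).trans hx)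
    have a2 {x y : ℂ} {a c : ℝ} (hx : ‖x‖ ≤ a) (hy : ‖y‖ ≤ c) : ‖x + y‖ ≤ a + c :=
      norm_add_le_of_le hx hy
    have s2 {x y : ℂ} {a c : ℝ} (hx : ‖x‖ ≤ a) (hy : ‖y‖ ≤ c) : ‖x - y‖ ≤ a + c :=
      norm_sub_le_of_le hx hy
    have n2 : ‖(2 : ℂ)‖ ≤ 2 := by simp
    have n3 : ‖(3 : ℂ)‖ ≤ 3 := by simp
    have n6 : ‖(6 : ℂ)‖ ≤ 6 := by simp
    have q1 : b ≤ b ^ 4 := le_self_pow₀ hb1 (by norm_num)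
    have q2 : b ^ 2 ≤ b ^ 4 := pow_le_pow_right₀ hb1 (by norm_num)
    have q3 : b ^ 3 ≤ b ^ 4 := pow_le_pow_right₀ hb1 (by norm_num)
    have f0 : ‖psiLaplace s‖ ≤ 2 * b ^ 4 :=
      (hdiv _).trans ((a2 (norm_one.le) r1).trans (by linarith))
    have f1 : ‖F₁ s‖ ≤ 2 * b ^ 4 := by
      have h := s2 r2 (m2 r1 r1)
      linarith
    have f2 : ‖F₂ s‖ ≤ 6 * b ^ 4 := by
      have h := a2 (s2 r3 (m2 n3 (m2 r1 r2))) (m2 n2 (m2 (m2 r1 r1) r1))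
      linarith
    have f3 : ‖F₃ s‖ ≤ 26 * b ^ 4 := by
      have t1 := s2 r4 (m2 r3 r1)
      have d := s2 r2 (m2 r1 r1)
      have t2 := m2 n3 (m2 d r2)
      have t3 := m2 n3 (m2 r1 (s2 r3 (m2 r2 r1)))
      have h := a2 (s2 (s2 t1 t2) t3) (m2 n6 (m2 (m2 r1 r1) d))
      linarith
    have g1 : ‖G₁ s‖ ≤ 4 * b ^ 4 := (hdiv _).trans ((a2 f1 f0).trans (by linarith))
    have g2 : ‖G₂ s‖ ≤ 14 * b ^ 4 := (hdiv _).trans ((a2 (a2 f2 g1) g1).trans (by linarith))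
    have hpow : p ^ 4 = τ ^ (1 / 3 : ℝ) := by
      rw [hp, ← Real.rpow_mul_natCast (by linarith)]
      norm_num
    have hpow2 : τ ^ (-(2 / 3) : ℝ) = τ ^ (1 / 3 : ℝ) / τ := by
      rw [← Real.rpow_sub_one (by linarith)]
      norm_num
    calc ‖G₃ s‖ = ‖F₃ s + G₂ s + G₂ s + G₂ s‖ / ‖s‖ := by rw [norm_div, norm_neg]
      _ ≤ (26 * b ^ 4 + 14 * b ^ 4 + 14 * b ^ 4 + 14 * b ^ 4) / (τ / 2) := by
          gcongr
          exact a2 (a2 (a2 f3 g2) g2) g2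
      _ = 136 * M ^ 4 * τ ^ (-(2 / 3) : ℝ) := by
          rw [hpow2, ← hpow, hb]
          field_simp
          norm_num
      _ ≤ 200 * M ^ 4 * τ ^ (-(2 / 3) : ℝ) := by
          gcongr
          norm_num

/-- The normalized Chebyshev function `ψ(eᵘ) e⁻ᵘ` on a logarithmic scale. -/
noncomputable def psiRatio (u : ℝ) : ℝ := Chebyshev.psi (exp u) * exp (-u)

lemma psiRatio_nonneg (u : ℝ) : 0 ≤ psiRatio u :=
  mul_nonneg (Chebyshev.psi_nonneg _) (exp_pos _).le

lemma psiRatio_le (u : ℝ) : psiRatio u ≤ log 4 + 4 := by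
  have h := mul_le_mul_of_nonneg_right (Chebyshev.psi_le_const_mul_self (exp_pos u).le)
    (exp_pos (-u)).le
  rwa [mul_assoc, ← exp_add, add_neg_cancel, exp_zero, mul_one] at h

lemma measurable_psiRatio : Measurable psiRatio :=
  (Chebyshev.psi_mono.measurable.comp measurable_exp).mul (measurable_exp.comp measurable_neg)

lemma psiRatio_mul_exp_le {u v : ℝ} (h : u ≤ v) : psiRatio u * exp (u - v) ≤ psiRatio v := by
  rw [psiRatio, mul_assoc, ← exp_add, psiRatio, show -u + (u - v) = -v by ring]
  gcongr

/-- The damped prime number error term `(ψ(eᵘ) e⁻ᵘ - 1) e^(-εu)` on the positive half-line. -/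
noncomputable def psiError (ε u : ℝ) : ℝ :=
  (Set.Ioi 0).indicator (fun u ↦ (psiRatio u - 1) * exp (-ε * u)) u

lemma measurable_psiError (ε : ℝ) : Measurable (psiError ε) :=
  ((measurable_psiRatio.sub_const 1).mul
    (measurable_exp.comp (measurable_const_mul (-ε)))).indicator measurableSet_Ioi

lemma abs_psiRatio_sub_one_le (u : ℝ) : |psiRatio u - 1| ≤ log 4 + 4 := by
  have := psiRatio_nonneg u
  have := psiRatio_le u
  have : 0 ≤ log 4 := log_nonneg (by norm_num)
  rw [abs_le]
  constructor <;> linarith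

lemma integrable_pow_mul_psiError (n : ℕ) {ε : ℝ} (hε : 0 < ε) :
    MeasureTheory.Integrable (fun u ↦ u ^ n * psiError ε u) := by
  have h0 : MeasureTheory.IntegrableOn (fun u : ℝ ↦ (log 4 + 4) * (u ^ (n : ℝ) * exp (-ε * u)))
      (Set.Ioi 0) :=
    (integrableOn_rpow_mul_exp_neg_mul_rpow (s := n) (p := 1) (by
      have : (0 : ℝ) ≤ n := n.cast_nonneg
      linarith) one_pos hε).congr_fun (fun u _ ↦ by simp) measurableSet_Ioi |>.const_mul _
  rw [← MeasureTheory.integrable_indicator_iff measurableSet_Ioi] at h0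
  refine h0.mono' (by
    exact ((measurable_id.pow_const n).mul (measurable_psiError ε)).aestronglyMeasurable)
    (Eventually.of_forall fun u ↦ ?_)
  by_cases hu : u ∈ Set.Ioi (0 : ℝ)
  · have hu' : 0 < u := hu
    simp only [psiError, Set.indicator_of_mem hu, norm_mul, norm_eq_abs, abs_exp, rpow_natCast,
      abs_pow, abs_of_pos hu']
    have := abs_psiRatio_sub_one_le u
    calc u ^ n * (|psiRatio u - 1| * exp (-ε * u)) ≤ u ^ n * ((log 4 + 4) * exp (-ε * u)) := by
          gcongr
      _ = _ := by ring
  · simp [psiError, Set.indicator_of_notMem hu]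

lemma psiLaplace_eq {s : ℂ} (hs : 1 < s.re) :
    psiLaplace s = (-deriv riemannZeta s / riemannZeta s) / s - 1 / (s - 1) := by
  have hs1 : s ≠ 1 := by rintro rfl; simp at hs
  have hs0 : s ≠ 0 := by rintro rfl; simp at hs; linarith
  have hsub : s - 1 ≠ 0 := sub_ne_zero.2 hs1
  have hζ : riemannZeta s ≠ 0 := riemannZeta_ne_zero_of_one_lt_re hs
  have hd : deriv zetaRegular s = riemannZeta s + (s - 1) * deriv riemannZeta s := by
    have h1 : zetaRegular =ᶠ[nhds s] fun z ↦ (z - 1) * riemannZeta z := by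
      filter_upwards [isOpen_ne.mem_nhds hs1] with z hz
      exact zetaRegular_of_ne hz
    rw [h1.deriv_eq, deriv_fun_mul (by fun_prop) (differentiableAt_riemannZeta hs1)]
    simp
  rw [psiLaplace, zetaRatio, iteratedDeriv_one, hd, zetaRegular_of_ne hs1]
  field_simp
  ring

lemma exp_mul_psi_exp_mul_cpow (s : ℂ) (u : ℝ) :
    (exp u : ℝ) • ((Chebyshev.psi (exp u) : ℂ) * ((exp u : ℝ) : ℂ) ^ (-(s + 1))) =
      psiRatio u * Complex.exp (-(s - 1) * u) := by
  rw [Complex.cpow_def_of_ne_zero (by exact_mod_cast (exp_pos u).ne'), ← Complex.ofReal_log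
    (exp_pos u).le, log_exp, psiRatio, Complex.real_smul]
  push_cast
  rw [mul_left_comm, ← Complex.exp_add, mul_assoc, ← Complex.exp_add]
  congr 2
  ring

lemma integral_psiRatio_mul_exp {s : ℂ} (hs : 1 < s.re) :
    ∫ u : ℝ in Set.Ioi 0, psiRatio u * Complex.exp (-(s - 1) * u) =
      (-deriv riemannZeta s / riemannZeta s) / s := by
  have hs0 : s ≠ 0 := by rintro rfl; simp at hs; linarith
  have hpsi (x : ℝ) : Chebyshev.psi x =
      ∑ k ∈ Finset.Icc 1 ⌊x⌋₊, ArithmeticFunction.vonMangoldt k := by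
    rw [Chebyshev.psi_eq_sum_Icc, ← Finset.insert_Icc_succ_left_eq_Icc (Nat.zero_le _),
      Finset.sum_insert (by simp)]
    simp
  have h := LSeries_eq_mul_integral_of_nonneg (fun n ↦ ArithmeticFunction.vonMangoldt n)
    zero_le_one hs (by
      refine Asymptotics.IsBigO.of_bound (log 4 + 4) (Eventually.of_forall fun n ↦ ?_)
      have h1 := hpsi n
      rw [Nat.floor_natCast] at h1
      rw [← h1, rpow_one, norm_of_nonneg (Chebyshev.psi_nonneg _),
        norm_of_nonneg (Nat.cast_nonneg n)]
      exact Chebyshev.psi_le_const_mul_self n.cast_nonneg)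
    (fun n ↦ ArithmeticFunction.vonMangoldt_nonneg)
  rw [ArithmeticFunction.LSeries_vonMangoldt_eq_deriv_riemannZeta_div hs] at h
  rw [h, mul_div_cancel_left₀ _ hs0]
  have h2 := MeasureTheory.integral_comp_exp_Ioi
    (fun y : ℝ ↦ (Chebyshev.psi y : ℂ) * (y : ℂ) ^ (-(s + 1))) 0
  simp only [exp_mul_psi_exp_mul_cpow, exp_zero] at h2
  rw [h2]
  simp only [hpsi, Complex.ofReal_sum]

theorem fourier_psiError {ε : ℝ} (hε : 0 < ε) (t : ℝ) :
    FourierTransform.fourier (fun u ↦ (psiError ε u : ℂ)) t =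
      psiLaplace (1 + ε + 2 * π * t * Complex.I) := by
  set s : ℂ := 1 + ε + 2 * π * t * Complex.I with hs
  have hre : s.re = 1 + ε := by simp [hs]
  have hs1 : 1 < s.re := by linarith
  have hneg : (-(s - 1)).re < 0 := by simp [hre, hε]
  rw [psiLaplace_eq hs1, ← integral_psiRatio_mul_exp hs1, fourier_real_eq_integral_exp_smul]
  have hI := integrableOn_exp_mul_complex_Ioi hneg 0
  have hval : ∫ u : ℝ in Set.Ioi 0, Complex.exp (-(s - 1) * u) = 1 / (s - 1) := by
    rw [integral_exp_mul_complex_Ioi hneg, ← neg_div_neg_eq]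
    simp
  rw [← hval, ← MeasureTheory.integral_sub _ hI]
  · rw [← MeasureTheory.integral_indicator measurableSet_Ioi]
    congr 1 with u
    by_cases hu : u ∈ Set.Ioi (0 : ℝ)
    · simp only [psiError, Set.indicator_of_mem hu]
      push_cast
      rw [smul_eq_mul, mul_left_comm, ← Complex.exp_add, sub_mul, one_mul]
      have : -2 * (π : ℂ) * u * t * Complex.I + -ε * u = -(s - 1) * u := by rw [hs]; ring
      rw [this]
    · simp [psiError, Set.indicator_of_notMem hu]
  · refine (hI.bdd_mul (c := log 4 + 4) ?_ ?_)
    · exact (Complex.measurable_ofReal.comp measurable_psiRatio).aestronglyMeasurable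
    · refine Eventually.of_forall fun u ↦ ?_
      simpa [abs_of_nonneg (psiRatio_nonneg u)] using psiRatio_le u

theorem exists_norm_fourier_cube_psiError_le : ∃ C, 0 < C ∧ ∀ ε : ℝ, 0 < ε → ε ≤ 1 → ∀ t : ℝ, t ≠ 0 →
    ‖FourierTransform.fourier (fun u : ℝ ↦ ((u ^ 3 * psiError ε u : ℝ) : ℂ)) t‖ ≤
      C * |t| ^ (-(2 / 3) : ℝ) := by
  obtain ⟨G₁, G₂, G₃, hG, C, hC, hb⟩ := exists_psiLaplace_derivatives
  refine ⟨C, hC, fun ε hε hε1 t ht ↦ ?_⟩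
  have hline (G G' : ℂ → ℂ) (h : ∀ s : ℂ, 1 < s.re → HasDerivAt G (G' s) s) (c : ℂ) :
      deriv (fun t : ℝ ↦ c * G (1 + ε + 2 * π * t * Complex.I)) =
        fun t : ℝ ↦ (c * (2 * π * Complex.I)) * G' (1 + ε + 2 * π * t * Complex.I) := by
    funext t
    have h1 : HasDerivAt (fun z : ℂ ↦ 1 + (ε : ℂ) + 2 * π * z * Complex.I)
        (2 * π * Complex.I) (t : ℂ) := by
      simpa using (((hasDerivAt_id (t : ℂ)).const_mul (2 * (π : ℂ))).mul_const
        Complex.I).const_add (1 + (ε : ℂ))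
    have h2 := ((h (1 + ε + 2 * π * t * Complex.I) (by simp [hε])).comp (t : ℂ) h1).const_mul c
    have h3 := h2.comp_ofReal.deriv
    simp only [Function.comp_def] at h3
    rw [h3]
    ring
  have hF : FourierTransform.fourier (fun u ↦ (psiError ε u : ℂ)) =
      fun t : ℝ ↦ 1 * psiLaplace (1 + ε + 2 * π * t * Complex.I) := by
    funext t
    rw [fourier_psiError hε, one_mul]
  have h3 : iteratedDeriv 3 (FourierTransform.fourier (fun u ↦ (psiError ε u : ℂ))) =
      fun t : ℝ ↦ (2 * π * Complex.I) ^ 3 * G₃ (1 + ε + 2 * π * t * Complex.I) := by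
    rw [hF, iteratedDeriv_succ, iteratedDeriv_succ, iteratedDeriv_one,
      hline _ _ fun s hs ↦ (hG s hs).1, hline _ _ fun s hs ↦ (hG s hs).2.1,
      hline _ _ fun s hs ↦ (hG s hs).2.2]
    funext t
    ring
  rw [iteratedDeriv_fourier (N := 3) (fun n _ ↦ by
    simpa [Complex.real_smul] using (integrable_pow_mul_psiError n hε).ofReal (𝕜 := ℂ)) le_rfl]
    at h3
  have h4 : (fun u : ℝ ↦ (-2 * (π : ℂ) * Complex.I * u) ^ 3 • (psiError ε u : ℂ)) =
      (-2 * (π : ℂ) * Complex.I) ^ 3 • fun u : ℝ ↦ ((u ^ 3 * psiError ε u : ℝ) : ℂ) := by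
    funext u
    simp only [smul_eq_mul, Pi.smul_apply]
    push_cast
    ring
  have h5 := congrFun h3 t
  have h6 : FourierTransform.fourier ((-2 * (π : ℂ) * Complex.I) ^ 3 •
      fun u : ℝ ↦ ((u ^ 3 * psiError ε u : ℝ) : ℂ)) t = (-2 * (π : ℂ) * Complex.I) ^ 3 *
      FourierTransform.fourier (fun u : ℝ ↦ ((u ^ 3 * psiError ε u : ℝ) : ℂ)) t :=
    congrFun (VectorFourier.fourierIntegral_const_smul _ _ _ _ _) t
  rw [h4, h6] at h5
  have h7 := congrArg norm h5
  simp only [norm_mul, norm_pow, norm_neg, Complex.norm_I, Complex.norm_real, Complex.norm_ofNat]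
    at h7
  have h8 := mul_left_cancel₀ (by simp [pi_ne_zero]) h7
  rw [h8]
  refine (hb _ (by simp [hε]) (by simp; linarith)).trans ?_
  refine mul_le_mul_of_nonneg_left ?_ hC.le
  refine rpow_le_rpow_of_nonpos (abs_pos.2 ht) ?_ (by norm_num)
  have him : (1 + (ε : ℂ) + 2 * π * t * Complex.I).im = 2 * π * t := by simp
  rw [him, abs_mul, abs_of_pos two_pi_pos]
  nlinarith [abs_nonneg t, pi_gt_three]

lemma integrable_abs_rpow_mul_exp_neg_pi_mul_sq {s : ℝ} (hs : -1 < s) :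
    MeasureTheory.Integrable (fun x : ℝ ↦ |x| ^ s * exp (-π * x ^ 2)) := by
  have h1 := (MeasureTheory.integrable_indicator_iff measurableSet_Ioi).2
    (integrableOn_rpow_mul_exp_neg_mul_sq pi_pos hs)
  refine (h1.add h1.comp_neg).mono' ?_ ?_
  · exact Measurable.aestronglyMeasurable (by fun_prop)
  · filter_upwards [MeasureTheory.Measure.ae_ne MeasureTheory.volume (0 : ℝ)] with x hx
    rw [norm_of_nonneg (by positivity)]
    rcases lt_or_gt_of_ne hx with h | h
    · simp [Set.indicator, h, not_lt.2 h.le, abs_of_neg h]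
    · simp [Set.indicator, h, not_lt.2 h.le, abs_of_pos h]

/-- Averages of `u³ (ψ(eᵘ) e⁻ᵘ - 1) e^(-εu)` over a Gaussian window of width `1 / T` are
`O(T^(1/3))`, uniformly in `ε`. -/
theorem exists_integral_cube_psiError_mul_gaussian_le : ∃ K, 0 < K ∧ ∀ ε : ℝ, 0 < ε → ε ≤ 1 →
    ∀ T : ℝ, 0 < T → ∀ c : ℝ,
      ∫ u : ℝ, u ^ 3 * psiError ε u * (T * exp (-π * (T * (u - c)) ^ 2)) ≤ K * T ^ (1 / 3 : ℝ) := by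
  obtain ⟨C, hC, hb⟩ := exists_norm_fourier_cube_psiError_le
  set J : ℝ := ∫ x : ℝ, |x| ^ (-(2 / 3) : ℝ) * exp (-π * x ^ 2) with hJ
  have hJi := integrable_abs_rpow_mul_exp_neg_pi_mul_sq (s := -(2 / 3)) (by norm_num)
  have hJ0 : 0 ≤ J := MeasureTheory.integral_nonneg fun x ↦ by positivity
  refine ⟨C * J + 1, by positivity, fun ε hε hε1 T hT c ↦ ?_⟩
  have hT2 : 0 < ((1 / T ^ 2 : ℝ) : ℂ).re := by
    rw [Complex.ofReal_re]
    positivity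
  set G : ℝ → ℂ := fun t ↦
    Complex.exp (-π * (1 / T ^ 2 : ℝ) * t ^ 2 + 2 * π * (Complex.I * c) * t) with hG
  have hGi : MeasureTheory.Integrable G := by
    have := integrable_cexp_quadratic' (b := -π * (1 / T ^ 2 : ℝ)) (by
      rw [← Complex.ofReal_neg, ← Complex.ofReal_mul, Complex.ofReal_re]
      have := pi_pos
      have : 0 < π * (1 / T ^ 2) := by positivity
      linarith) (2 * π * (Complex.I * c)) 0
    simpa only [add_zero] using this
  have hGF (u : ℝ) : FourierTransform.fourier G u =
      ((T * exp (-π * (T * (u - c)) ^ 2) : ℝ) : ℂ) := by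
    rw [hG, fourier_gaussian_pi' hT2]
    have hr : ((1 / T ^ 2 : ℝ) : ℂ) ^ (1 / 2 : ℂ) = ((1 / T : ℝ) : ℂ) := by
      rw [show (1 / 2 : ℂ) = ((1 / 2 : ℝ) : ℂ) by norm_num, ← Complex.ofReal_cpow (by positivity),
        ← sqrt_eq_rpow, ← one_div_pow, sqrt_sq (by positivity)]
    have hT0 : (T : ℂ) ≠ 0 := by exact_mod_cast hT.ne'
    simp only [hr]
    push_cast
    rw [one_div_one_div]
    congr 2
    have : (u : ℂ) + Complex.I * (Complex.I * c) = u - c := by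
      rw [← mul_assoc, Complex.I_mul_I]
      ring
    rw [this]
    field_simp
  have hGn (t : ℝ) : ‖G t‖ = exp (-π * (t / T) ^ 2) := by
    rw [hG, Complex.norm_exp]
    congr 1
    have : (-π * (1 / T ^ 2 : ℝ) * t ^ 2 + 2 * π * (Complex.I * c) * t : ℂ) =
        ((-π * (t / T) ^ 2 : ℝ) : ℂ) + ((2 * π * c * t : ℝ) : ℂ) * Complex.I := by
      push_cast
      ring
    rw [this, Complex.add_re, Complex.re_ofReal_mul, Complex.ofReal_re, Complex.I_re]
    ring
  set F : ℝ → ℂ := fun u ↦ ((u ^ 3 * psiError ε u : ℝ) : ℂ) with hF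
  have hFi : MeasureTheory.Integrable F := (integrable_pow_mul_psiError 3 hε).ofReal
  have hself : ∫ t, FourierTransform.fourier F t * G t =
      ∫ u, F u * FourierTransform.fourier G u := by
    have h := VectorFourier.integral_fourierIntegral_smul_eq_flip (L := innerₗ ℝ)
      continuous_fourierChar continuous_inner hFi hGi
    rwa [flip_innerₗ] at h
  set H : ℝ → ℝ := fun x ↦ |x| ^ (-(2 / 3) : ℝ) * exp (-π * x ^ 2) with hH
  have hmaj (t : ℝ) : C * |t| ^ (-(2 / 3) : ℝ) * exp (-π * (t / T) ^ 2) =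
      C * T ^ (-(2 / 3) : ℝ) * H (t / T) := by
    simp only [hH]
    rw [abs_div, abs_of_pos hT, div_rpow (abs_nonneg t) hT.le]
    field_simp
  have hTpow : T ^ (-(2 / 3) : ℝ) * T = T ^ (1 / 3 : ℝ) := by
    rw [← rpow_add_one hT.ne']
    norm_num
  have hre : ((∫ u : ℝ, u ^ 3 * psiError ε u * (T * exp (-π * (T * (u - c)) ^ 2)) : ℝ) : ℂ) =
      ∫ t, FourierTransform.fourier F t * G t := by
    rw [hself, ← integral_complex_ofReal]
    congr 1 with u
    rw [hGF, hF]
    push_cast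
    ring
  calc _ ≤ ‖∫ t, FourierTransform.fourier F t * G t‖ := by
        rw [← hre, Complex.norm_real]
        exact le_abs_self _
    _ ≤ ∫ t, C * T ^ (-(2 / 3) : ℝ) * H (t / T) := by
        refine MeasureTheory.norm_integral_le_of_norm_le ((hJi.comp_div hT.ne').const_mul _) ?_
        filter_upwards [MeasureTheory.Measure.ae_ne MeasureTheory.volume (0 : ℝ)] with t ht
        rw [← hmaj, norm_mul, hGn]
        exact mul_le_mul_of_nonneg_right (hb ε hε hε1 t ht) (exp_pos _).le
    _ = C * J * T ^ (1 / 3 : ℝ) := by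
        rw [MeasureTheory.integral_const_mul, MeasureTheory.Measure.integral_comp_div,
          abs_of_pos hT, smul_eq_mul, ← hTpow]
        ring
    _ ≤ _ := by
        gcongr
        linarith

lemma integrable_abs_pow_mul_exp_neg_pi_mul_sq (n : ℕ) :
    MeasureTheory.Integrable (fun x : ℝ ↦ |x| ^ n * exp (-π * x ^ 2)) := by
  have h := integrable_abs_rpow_mul_exp_neg_pi_mul_sq (s := n) (by
    have : (0 : ℝ) ≤ n := n.cast_nonneg
    linarith)
  simpa only [rpow_natCast] using h

lemma cube_le_of_window {U u : ℝ} (hU : 1 ≤ U) (hu : 0 < u) :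
    u ^ 3 ≤ (U + 1 / U ^ 2) ^ 3 + 19 * (|U ^ 3 * (u - (U + 1 / U ^ 2))| +
      |U ^ 3 * (u - (U + 1 / U ^ 2))| ^ 2 + |U ^ 3 * (u - (U + 1 / U ^ 2))| ^ 3) := by
  set c := U + 1 / U ^ 2 with hc
  have hc1 : c ≤ 2 * U := by
    have : 1 / U ^ 2 ≤ 1 := by
      rw [div_le_one (by positivity)]
      exact one_le_pow₀ hU
    linarith
  have hc0 : 0 < c := by positivity
  have hU3 : 1 ≤ U ^ 3 := one_le_pow₀ hU
  rw [abs_mul, abs_of_pos (by positivity : 0 < U ^ 3)]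
  set a := |u - c|
  have ha : 0 ≤ a := abs_nonneg _
  have hua : u ≤ c + a := by linarith [le_abs_self (u - c)]
  have hca : c ^ 2 * a ≤ 4 * (U ^ 3 * a) := by
    have : c ^ 2 ≤ 4 * U ^ 3 := by
      calc c ^ 2 ≤ (2 * U) ^ 2 := by gcongr
        _ = 4 * U ^ 2 := by ring
        _ ≤ 4 * U ^ 3 := by gcongr; norm_num
    nlinarith
  have hca2 : c * a ^ 2 ≤ 2 * (U ^ 3 * a) ^ 2 := by
    have : c ≤ 2 * (U ^ 3) ^ 2 := by
      have : U ≤ (U ^ 3) ^ 2 := by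
        rw [← pow_mul]
        exact le_self_pow₀ hU (by norm_num)
      linarith
    rw [mul_pow]
    nlinarith [sq_nonneg a]
  have ha3 : a ^ 3 ≤ (U ^ 3 * a) ^ 3 := by
    gcongr
    exact le_mul_of_one_le_left ha hU3
  have h0 : 0 ≤ U ^ 3 * a := by positivity
  have h1 : 0 ≤ (U ^ 3 * a) ^ 2 := by positivity
  have h2 : 0 ≤ (U ^ 3 * a) ^ 3 := by positivity
  calc u ^ 3 ≤ (c + a) ^ 3 := by gcongr
    _ = c ^ 3 + 3 * (c ^ 2 * a) + 3 * (c * a ^ 2) + a ^ 3 := by ring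
    _ ≤ _ := by linarith

lemma psiRatio_window_le {U ε u : ℝ} (hU : 1 ≤ U) (hε : 0 < ε) (hu : 0 < u) :
    U ^ 3 * psiRatio U * exp (-2 / U ^ 2) * exp (-ε * (U + 2 / U ^ 2)) *
      (1 - (U ^ 3 * (u - (U + 1 / U ^ 2))) ^ 2 / U ^ 2) ≤
      u ^ 3 * (psiRatio u * exp (-ε * u)) := by
  have hU0 : 0 < U := by linarith
  have hS := psiRatio_nonneg U
  have hSu := psiRatio_nonneg u
  by_cases h : |u - (U + 1 / U ^ 2)| ≤ 1 / U ^ 2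
  · obtain ⟨h1, h2⟩ := abs_le.1 h
    have hd : 2 / U ^ 2 = 1 / U ^ 2 + 1 / U ^ 2 := by ring
    have hUu : U ≤ u := by linarith
    have huU : u ≤ U + 2 / U ^ 2 := by linarith
    have hb : psiRatio U * exp (-2 / U ^ 2) ≤ psiRatio u := by
      refine le_trans ?_ (psiRatio_mul_exp_le hUu)
      gcongr
      rw [neg_div]
      linarith
    calc _ ≤ U ^ 3 * psiRatio U * exp (-2 / U ^ 2) * exp (-ε * (U + 2 / U ^ 2)) :=
          mul_le_of_le_one_right (by positivity) (by
            have : 0 ≤ (U ^ 3 * (u - (U + 1 / U ^ 2))) ^ 2 / U ^ 2 := by positivity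
            linarith)
      _ = U ^ 3 * ((psiRatio U * exp (-2 / U ^ 2)) * exp (-ε * (U + 2 / U ^ 2))) := by ring
      _ ≤ _ := by
        gcongr ?_ ^ 3 * (?_ * exp ?_)
        nlinarith
  · have hneg : 1 - (U ^ 3 * (u - (U + 1 / U ^ 2))) ^ 2 / U ^ 2 ≤ 0 := by
      rw [sub_nonpos, one_le_div (by positivity), sq_le_sq, abs_mul, abs_of_pos hU0,
        abs_of_pos (by positivity : 0 < U ^ 3)]
      calc U = U ^ 3 * (1 / U ^ 2) := by field_simp
        _ ≤ _ := by
          gcongr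
          exact (not_le.1 h).le
    exact (mul_nonpos_of_nonneg_of_nonpos (by positivity) hneg).trans (by positivity)

theorem exists_psiRatio_le : ∃ K, 0 < K ∧ ∀ U : ℝ, 1 ≤ U → psiRatio U ≤ 1 + K / U ^ 2 := by
  obtain ⟨K, hK, hb⟩ := exists_integral_cube_psiError_mul_gaussian_le
  let W : ℕ → ℝ → ℝ := fun n x ↦ |x| ^ n * exp (-π * x ^ 2)
  have hW (n : ℕ) : MeasureTheory.Integrable (W n) := integrable_abs_pow_mul_exp_neg_pi_mul_sq n
  let m : ℕ → ℝ := fun n ↦ ∫ x, W n x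
  have hm (n : ℕ) : 0 ≤ m n := MeasureTheory.integral_nonneg fun x ↦ by positivity
  have hm0 : m 0 = 1 := by
    have := integral_gaussian π
    rw [div_self pi_ne_zero, sqrt_one] at this
    simpa [m, W] using this
  set M : ℝ := m 1 + m 2 + m 3 with hM
  have hM0 : 0 ≤ M := add_nonneg (add_nonneg (hm 1) (hm 2)) (hm 3)
  have key (U : ℝ) (hU : 1 ≤ U) (ε : ℝ) (hε : 0 < ε) (hε1 : ε ≤ 1) :
      U ^ 3 * psiRatio U * exp (-2 / U ^ 2) * exp (-ε * (U + 2 / U ^ 2)) * (1 - m 2 / U ^ 2) ≤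
        (U + 1 / U ^ 2) ^ 3 + 19 * M + K * U := by
    have hU0 : 0 < U := by linarith
    set A := U ^ 3 * psiRatio U * exp (-2 / U ^ 2) * exp (-ε * (U + 2 / U ^ 2)) with hA
    set c := U + 1 / U ^ 2 with hc
    let φ : ℝ → ℝ := fun w ↦ (A - c ^ 3) * W 0 w - 19 * W 1 w - (19 + A / U ^ 2) * W 2 w -
      19 * W 3 w
    have hφ : MeasureTheory.Integrable φ :=
      ((((hW 0).const_mul _).sub ((hW 1).const_mul _)).sub ((hW 2).const_mul _)).sub
        ((hW 3).const_mul _)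
    have hφint : ∫ w, φ w = A * (1 - m 2 / U ^ 2) - c ^ 3 - 19 * M := by
      have : ∫ w, φ w = (A - c ^ 3) * m 0 - 19 * m 1 - (19 + A / U ^ 2) * m 2 - 19 * m 3 := by
        have h0 := (hW 0).const_mul (A - c ^ 3)
        have h1 := (hW 1).const_mul 19
        have h2 := (hW 2).const_mul (19 + A / U ^ 2)
        have h3 := (hW 3).const_mul 19
        have e1 := MeasureTheory.integral_sub ((h0.sub h1).sub h2) h3
        have e2 := MeasureTheory.integral_sub (h0.sub h1) h2
        have e3 := MeasureTheory.integral_sub h0 h1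
        simp only [Pi.sub_apply, MeasureTheory.integral_const_mul] at e1 e2 e3
        simp only [φ, e1, e2, e3, m]
      rw [this, hm0, hM]
      ring
    have hT : 0 < U ^ 3 := by positivity
    have hsub : ∫ u, φ (U ^ 3 * (u - c)) * U ^ 3 = ∫ w, φ w := by
      rw [MeasureTheory.integral_mul_const,
        MeasureTheory.integral_sub_right_eq_self (fun u ↦ φ (U ^ 3 * u)) c,
        MeasureTheory.Measure.integral_comp_mul_left, abs_of_pos (by positivity), smul_eq_mul]
      field_simp
    have hpow : (U ^ 3) ^ (1 / 3 : ℝ) = U := by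
      rw [← rpow_natCast, ← rpow_mul hU0.le]
      norm_num
    have hbU := hb ε hε hε1 (U ^ 3) hT c
    rw [hpow] at hbU
    have hmono : ∫ u, φ (U ^ 3 * (u - c)) * U ^ 3 ≤
        ∫ u : ℝ, u ^ 3 * psiError ε u * (U ^ 3 * exp (-π * (U ^ 3 * (u - c)) ^ 2)) := by
      refine MeasureTheory.integral_mono ?_ ?_ fun u ↦ ?_
      · exact ((hφ.comp_mul_left' hT.ne').comp_sub_right c).mul_const _
      · refine (integrable_pow_mul_psiError 3 hε).mul_bdd (c := U ^ 3) ?_ ?_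
        · exact Measurable.aestronglyMeasurable (by fun_prop)
        · refine Eventually.of_forall fun u ↦ ?_
          rw [norm_of_nonneg (by positivity)]
          refine mul_le_of_le_one_right hT.le (exp_le_one_iff.2 ?_)
          have : 0 ≤ π * (U ^ 3 * (u - c)) ^ 2 := by positivity
          linarith
      · set w := U ^ 3 * (u - c) with hw
        have hpt : A * (1 - w ^ 2 / U ^ 2) - (c ^ 3 + 19 * (|w| + |w| ^ 2 + |w| ^ 3)) ≤
            u ^ 3 * psiError ε u := by
          by_cases hu : 0 < u
          · have e1 := psiRatio_window_le hU hε hu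
            have e2 := cube_le_of_window hU hu
            have e3 : u ^ 3 * exp (-ε * u) ≤ u ^ 3 :=
              mul_le_of_le_one_right (by positivity) (exp_le_one_iff.2 (by nlinarith))
            rw [psiError, Set.indicator_of_mem (Set.mem_Ioi.2 hu)]
            exact (sub_le_sub e1 (e3.trans e2)).trans_eq (by ring)
          · have hA0 : 0 ≤ A := by
              have := psiRatio_nonneg U
              positivity
            have hc0 : 0 < c := by positivity
            have hwU : U ^ 2 ≤ w ^ 2 := by
              rw [sq_le_sq, abs_of_pos hU0, hw, abs_mul, abs_of_pos hT,
                abs_of_neg (by linarith)]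
              have : U ≤ U ^ 3 := le_self_pow₀ hU (by norm_num)
              have : 1 ≤ U ^ 3 := one_le_pow₀ hU
              have : U ≤ c := by
                have : 0 < 1 / U ^ 2 := by positivity
                linarith
              nlinarith
            have : A * (1 - w ^ 2 / U ^ 2) ≤ 0 := by
              refine mul_nonpos_of_nonneg_of_nonpos hA0 ?_
              rwa [sub_nonpos, one_le_div (by positivity)]
            rw [psiError, Set.indicator_of_notMem (by simpa using hu), mul_zero]
            have : 0 ≤ c ^ 3 + 19 * (|w| + |w| ^ 2 + |w| ^ 3) := by positivity
            linarith
        calc φ w * U ^ 3 = (A * (1 - w ^ 2 / U ^ 2) - (c ^ 3 + 19 * (|w| + |w| ^ 2 + |w| ^ 3))) *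
              (U ^ 3 * exp (-π * w ^ 2)) := by
              simp only [φ, W, sq_abs]
              ring
          _ ≤ _ := by gcongr
    linarith
  refine ⟨7 + 19 * M + K + (log 4 + 4) * (2 + m 2), ?_, fun U hU ↦ ?_⟩
  · have : 0 ≤ log 4 := log_nonneg (by norm_num)
    have := hm 2
    positivity
  have hU0 : 0 < U := by linarith
  have hlim : Tendsto (fun ε : ℝ ↦ U ^ 3 * psiRatio U * exp (-2 / U ^ 2) *
      exp (-ε * (U + 2 / U ^ 2)) * (1 - m 2 / U ^ 2)) (nhdsWithin 0 (Set.Ioi 0))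
      (nhds (U ^ 3 * psiRatio U * exp (-2 / U ^ 2) * (1 - m 2 / U ^ 2))) := by
    have : ContinuousAt (fun ε : ℝ ↦ U ^ 3 * psiRatio U * exp (-2 / U ^ 2) *
      exp (-ε * (U + 2 / U ^ 2)) * (1 - m 2 / U ^ 2)) 0 := by fun_prop
    simpa [ContinuousAt] using this.tendsto.mono_left nhdsWithin_le_nhds
  have hle := le_of_tendsto hlim (by
    filter_upwards [Ioc_mem_nhdsGT one_pos] with ε hε using key U hU ε hε.1 hε.2)
  have hS := psiRatio_nonneg U
  have hS6 := psiRatio_le U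
  have hcube : (U + 1 / U ^ 2) ^ 3 + 19 * M + K * U ≤
      U ^ 3 * (1 + (7 + 19 * M + K) / U ^ 2) := by
    have h1 : 1 / U ^ 3 ≤ 1 := by
      rw [div_le_one (by positivity)]
      exact one_le_pow₀ hU
    have h2 : 1 / U ^ 6 ≤ 1 := by
      rw [div_le_one (by positivity)]
      exact one_le_pow₀ hU
    have e1 : (U + 1 / U ^ 2) ^ 3 = U ^ 3 + 3 + 3 * (1 / U ^ 3) + 1 / U ^ 6 := by
      field_simp
      ring
    have e2 : U ^ 3 * (1 + (7 + 19 * M + K) / U ^ 2) = U ^ 3 + (7 + 19 * M + K) * U := by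
      field_simp
    rw [e1, e2]
    nlinarith
  have hexp : psiRatio U * (1 - (2 + m 2) / U ^ 2) ≤
      psiRatio U * exp (-2 / U ^ 2) * (1 - m 2 / U ^ 2) := by
    rw [mul_assoc]
    refine mul_le_mul_of_nonneg_left ?_ hS
    have h1 : 1 - 2 / U ^ 2 ≤ exp (-2 / U ^ 2) := by
      have := add_one_le_exp (-2 / U ^ 2)
      rw [neg_div] at this ⊢
      linarith
    have h2 : exp (-2 / U ^ 2) ≤ 1 := exp_le_one_iff.2 (by rw [neg_div, neg_nonpos]; positivity)
    have h3 : 0 ≤ m 2 / U ^ 2 := div_nonneg (hm 2) (by positivity)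
    rw [add_div]
    nlinarith
  have hmain : psiRatio U * exp (-2 / U ^ 2) * (1 - m 2 / U ^ 2) ≤
      1 + (7 + 19 * M + K) / U ^ 2 := by
    refine le_of_mul_le_mul_left ?_ (by positivity : 0 < U ^ 3)
    calc _ = U ^ 3 * psiRatio U * exp (-2 / U ^ 2) * (1 - m 2 / U ^ 2) := by ring
      _ ≤ _ := hle.trans hcube
  have hlast : psiRatio U * ((2 + m 2) / U ^ 2) ≤ (log 4 + 4) * (2 + m 2) / U ^ 2 := by
    rw [mul_div_assoc]
    refine mul_le_mul_of_nonneg_right hS6 (div_nonneg ?_ (by positivity))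
    linarith [hm 2]
  rw [add_div]
  linarith

lemma exists_theta_le : ∃ K, 0 < K ∧ ∀ x : ℝ, exp 1 ≤ x →
    Chebyshev.theta x ≤ x + K * x / log x ^ 2 := by
  obtain ⟨K, hK, h⟩ := exists_psiRatio_le
  refine ⟨K, hK, fun x hx ↦ (Chebyshev.theta_le_psi x).trans ?_⟩
  have hx0 : 0 < x := (exp_pos 1).trans_le hx
  have h1 := h (log x) ((le_log_iff_exp_le hx0).2 hx)
  rw [psiRatio, exp_log hx0, exp_neg, exp_log hx0, ← div_eq_mul_inv, div_le_iff₀ hx0] at h1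
  exact h1.trans_eq (by ring)

lemma hasDerivAt_div_log_pow (n : ℕ) {x : ℝ} (hx : 1 < x) :
    HasDerivAt (fun x ↦ x / log x ^ n) (1 / log x ^ n - n / log x ^ (n + 1)) x := by
  have hl : 0 < log x := log_pos hx
  have h := (hasDerivAt_id x).div ((hasDerivAt_log (by positivity)).pow n) (pow_pos hl n).ne'
  convert! h using 1
  rcases n with _ | n
  · simp
  · simp only [id, add_tsub_cancel_right, Pi.pow_apply]
    field_simp
    ring

theorem exists_primeCounting_le : ∃ C, 0 < C ∧ ∀ᶠ x : ℝ in atTop,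
    (Nat.primeCounting ⌊x⌋₊ : ℝ) ≤ x / log x + x / log x ^ 2 + C * (x / log x ^ 3) := by
  obtain ⟨K, hK, hθ⟩ := exists_theta_le
  set a : ℝ := exp (9 + K) with ha
  have ha9 : exp 1 ≤ a := exp_le_exp.2 (by linarith)
  have h2e : (2 : ℝ) ≤ exp 1 := by linarith [add_one_le_exp 1]
  have ha2 : 2 ≤ a := h2e.trans ha9
  set I : ℝ := ∫ t in (2 : ℝ)..a, Chebyshev.theta t / (t * log t ^ 2) with hI
  refine ⟨K + 4, by positivity, ?_⟩
  have hlog : Tendsto (fun x : ℝ ↦ x / log x ^ 3) atTop atTop := by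
    have h := (tendsto_exp_div_pow_atTop 3).comp tendsto_log_atTop
    refine h.congr' ?_
    filter_upwards [eventually_gt_atTop 0] with x hx
    simp [exp_log hx]
  filter_upwards [eventually_ge_atTop a, hlog.eventually_ge_atTop I] with x hx hxI
  have hx2 : 2 ≤ x := ha2.trans hx
  have hxl : 0 < log x := log_pos (by linarith)
  have hint := Chebyshev.integrableOn_theta_div_id_mul_log_sq x
  have hii {b c : ℝ} (hb : 2 ≤ b) (hbc : b ≤ c) (hc : c ≤ x) : IntervalIntegrable
      (fun t ↦ Chebyshev.theta t / (t * log t ^ 2)) MeasureTheory.volume b c := by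
    rw [intervalIntegrable_iff_integrableOn_Icc_of_le hbc]
    exact hint.mono_set (Set.Icc_subset_Icc hb hc)
  have hder (t : ℝ) (ht : a ≤ t) : HasDerivAt (fun t ↦ t / log t ^ 2 + 3 * (t / log t ^ 3))
      ((1 / log t ^ 2 - (2 : ℕ) / log t ^ (2 + 1)) +
        3 * (1 / log t ^ 3 - (3 : ℕ) / log t ^ (3 + 1))) t :=
    (hasDerivAt_div_log_pow 2 (by linarith)).add ((hasDerivAt_div_log_pow 3
      (by linarith)).const_mul 3)
  have hmain : ∫ t in a..x, Chebyshev.theta t / (t * log t ^ 2) ≤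
      (x / log x ^ 2 + 3 * (x / log x ^ 3)) - (a / log a ^ 2 + 3 * (a / log a ^ 3)) := by
    refine intervalIntegral.integral_le_sub_of_hasDeriv_right_of_le hx
      (fun t ht ↦ (hder t ht.1).continuousAt.continuousWithinAt)
      (fun t ht ↦ (hder t ht.1.le).hasDerivWithinAt)
      (hint.mono_set (Set.Icc_subset_Icc_left ha2)) fun t ht ↦ ?_
    have hta : a ≤ t := ht.1.le
    have ht0 : 0 < t := by linarith
    have hl : 9 + K ≤ log t := (le_log_iff_exp_le ht0).2 hta
    have hl0 : 0 < log t := by linarith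
    calc Chebyshev.theta t / (t * log t ^ 2) ≤ (t + K * t / log t ^ 2) / (t * log t ^ 2) := by
          gcongr
          exact hθ t (ha9.trans hta)
      _ = 1 / log t ^ 2 + K / log t ^ 4 := by field_simp
      _ ≤ 1 / log t ^ 2 + (log t - 9) / log t ^ 4 := by
          gcongr
          linarith
      _ = _ := by
          push_cast
          field_simp
          ring
  have ha0 : 0 ≤ a / log a ^ 2 + 3 * (a / log a ^ 3) := by
    have : 0 ≤ log a := log_nonneg (by linarith)
    positivity
  rw [Chebyshev.primeCounting_eq_theta_div_log_add_integral hx2,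
    ← intervalIntegral.integral_add_adjacent_intervals (hii le_rfl ha2 hx) (hii ha2 hx le_rfl)]
  have hθx : Chebyshev.theta x / log x ≤ x / log x + K * (x / log x ^ 3) := by
    calc _ ≤ (x + K * x / log x ^ 2) / log x := by
          gcongr
          exact hθ x (ha9.trans hx)
      _ = _ := by field_simp
  linarith

lemma monotoneOn_g : MonotoneOn g (Set.Ici (exp 1)) := by
  intro x hx y hy hxy
  have hx0 : 0 < x := (exp_pos 1).trans_le hx
  have hlx : 1 ≤ log x := (le_log_iff_exp_le hx0).2 hx
  have hl : log x ≤ log y := log_le_log hx0 hxy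
  have hll : log (log x) ≤ log (log y) := log_le_log (by linarith) hl
  have h0 : 0 ≤ log (log x) := log_nonneg hlx
  exact mul_le_mul hxy (by linarith) (by linarith) (hx0.le.trans hxy)

lemma le_g {x : ℝ} (hx : exp 2 ≤ x) : x ≤ g x := by
  have hx0 : 0 < x := (exp_pos 2).trans_le hx
  have hlx : 2 ≤ log x := (le_log_iff_exp_le hx0).2 hx
  have h0 : 0 ≤ log (log x) := log_nonneg (by linarith)
  exact le_mul_of_one_le_right hx0.le (by linarith)

lemma tendsto_g_atTop : Tendsto g atTop atTop :=
  tendsto_atTop_mono' atTop ((eventually_ge_atTop (exp 2)).mono fun _ ↦ le_g) tendsto_id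

lemma lt_nthPrime_of_primeCounting_lt {n : ℕ} {y : ℝ} (h : Nat.primeCounting ⌊y⌋₊ < n) :
    y < nthPrime n := by
  have h1 : Nat.count Nat.Prime (⌊y⌋₊ + 1) ≤ n - 1 := Nat.le_sub_one_of_lt h
  have h2 : ⌊y⌋₊ + 1 ≤ nthPrime n := (Nat.count_le_iff_le_nth Nat.infinite_setOfPred_prime).1 h1
  exact (Nat.lt_floor_add_one y).trans_le (by exact_mod_cast h2)

theorem eventually_g_lt_nthPrime : ∀ᶠ n : ℕ in atTop, g n < nthPrime n := by
  obtain ⟨C, hC, h⟩ := exists_primeCounting_le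
  have hll : Tendsto (fun x : ℝ ↦ log (log x)) atTop atTop :=
    tendsto_log_atTop.comp tendsto_log_atTop
  have key : ∀ᶠ x : ℝ in atTop, (Nat.primeCounting ⌊g x⌋₊ : ℝ) < x := by
    filter_upwards [tendsto_g_atTop.eventually h, eventually_ge_atTop (exp 2),
      hll.eventually_gt_atTop (C + 1)] with x hx hx2 hxC
    refine hx.trans_lt ?_
    have hx0 : 0 < x := (exp_pos 2).trans_le hx2
    have hl : 2 ≤ log x := (le_log_iff_exp_le hx0).2 hx2
    set l := log x
    set A := l + log l - 1 with hA
    have hlA : l ≤ A := by linarith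
    have hA0 : 0 < A := by linarith
    have hg : g x = x * A := rfl
    set w := log (A / l) with hw
    have hY : log (g x) = A + 1 + w := by
      rw [hg, log_mul hx0.ne' hA0.ne', hw, log_div hA0.ne' (by positivity)]
      ring
    rw [hg] at hY ⊢
    have hw1 : (log l - 1) / A ≤ w := by
      have := one_sub_inv_le_log_of_pos (x := A / l) (by positivity)
      refine le_trans (le_of_eq ?_) this
      rw [show log l - 1 = A - l by rw [hA]; ring]
      field_simp
    rw [hY]
    set Y := A + 1 + w
    have hw0 : 0 < w := (div_pos (by linarith) hA0).trans_le hw1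
    have hY0 : 0 < Y := by linarith
    have hw2 : C / Y < w := by
      refine lt_of_lt_of_le ?_ hw1
      gcongr <;> linarith
    have hAY : A = Y - 1 - w := by simp only [Y]; ring
    have hmain : A * (1 + 1 / Y + C / Y ^ 2) < Y := by
      have e : (Y - 1) * (1 + 1 / Y + C / Y ^ 2) = Y + C / Y - 1 / Y - C / Y ^ 2 := by
        field_simp
        ring
      have h1 : 0 < 1 / Y := by positivity
      have h2 : 0 < C / Y ^ 2 := by positivity
      have h3 : 0 < w * (1 / Y + C / Y ^ 2) := by positivity
      rw [hAY, sub_mul, e]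
      linarith
    calc x * A / Y + x * A / Y ^ 2 + C * (x * A / Y ^ 3) =
          x * (A * (1 + 1 / Y + C / Y ^ 2)) / Y := by field_simp
      _ < x * Y / Y := by gcongr
      _ = x := by field_simp
  filter_upwards [tendsto_natCast_atTop_atTop.eventually key] with n hn
  exact lt_nthPrime_of_primeCounting_lt (by exact_mod_cast hn)

lemma eventually_iterate_g_le_q (k : ℕ) : ∀ᶠ n : ℕ in atTop,
    g^[k] n ≤ q k n ∧ g^[k + 1] n < q (k + 1) n := by
  have hgk (k : ℕ) : Tendsto (fun n : ℕ ↦ g^[k] n) atTop atTop :=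
    (tendsto_g_atTop.iterate k).comp tendsto_natCast_atTop_atTop
  have step (k : ℕ) (h : ∀ᶠ n : ℕ in atTop, g^[k] n ≤ q k n) :
      ∀ᶠ n : ℕ in atTop, g^[k + 1] n < q (k + 1) n := by
    have hq : Tendsto (q k) atTop atTop :=
      tendsto_natCast_atTop_iff.1 (tendsto_atTop_mono' atTop h (hgk k))
    filter_upwards [h, (hgk k).eventually_ge_atTop (exp 1),
      hq.eventually eventually_g_lt_nthPrime] with n h1 h2 h3
    rw [q, Function.iterate_succ_apply', Function.iterate_succ_apply']
    exact (monotoneOn_g h2 (h2.trans h1) h1).trans_lt h3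
  have hle : ∀ᶠ n : ℕ in atTop, g^[k] n ≤ q k n := by
    induction k with
    | zero => simp [q]
    | succ k ih => exact (step k ih).mono fun _ ↦ le_of_lt
  exact hle.and (step k hle)

/-- For fixed `k ≥ 1` and all sufficiently large `n`, `q^k(n) > g^(k)(n)`. -/
theorem pip_order_k_lower_bound (k : ℕ) (hk : 1 ≤ k) :
    ∀ᶠ n : ℕ in atTop, (q k n : ℝ) > g^[k] n := by
  obtain ⟨k, rfl⟩ := Nat.exists_eq_add_of_le' hk
  exact (eventually_iterate_g_le_q k).mono fun _ h ↦ h.2
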